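/- If M ⊂ ℝ³ is a smoothly embedded Möbius strip, then λ(M)/2 is an odd integer; in particular λ(M) ≠ 0. -/

import Mathlib

/-- The integrand of the Gauss linking integral for two curves in `ℝ³`. -/
noncomputable def gaussLinkingIntegrand (γ₁ γ₂ : ℝ → EuclideanSpace ℝ (Fin 3))
    (s t : ℝ) : ℝ :=
  Matrix.det
      (Matrix.of ![fun j => deriv γ₁ s j, fun j => deriv γ₂ t j, fun j => (γ₁ s - γ₂ t) j])
    / ‖γ₁ s - γ₂ t‖ ^ 3

/-- The linking number of two disjoint (period-one) loops in `ℝ³`, via the Gauss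
linking integral. -/
noncomputable def linkingNumber (γ₁ γ₂ : ℝ → EuclideanSpace ℝ (Fin 3)) : ℝ :=
  (4 * Real.pi)⁻¹ * ∫ s in (0 : ℝ)..1, ∫ t in (0 : ℝ)..1, gaussLinkingIntegrand γ₁ γ₂ s t

open Filter Topology

/-- Euclidean three-space. -/
abbrev Space := EuclideanSpace ℝ (Fin 3)

/-- The scalar triple product of three vectors of `ℝ³`. -/
def tripleProduct (a b x : Space) : ℝ :=
  a 0 * (b 1 * x 2 - b 2 * x 1) - a 1 * (b 0 * x 2 - b 2 * x 0) + a 2 * (b 0 * x 1 - b 1 * x 0)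

lemma gaussLinkingIntegrand_eq (γ c : ℝ → Space) (s t : ℝ) :
    gaussLinkingIntegrand γ c s t =
      tripleProduct (deriv γ s) (deriv c t) (γ s - c t) / ‖γ s - c t‖ ^ 3 := by
  simp only [gaussLinkingIntegrand, Matrix.det_fin_three, tripleProduct]
  simp
  ring

/-! ### Spinors and the phase of a geodesic triangle -/

/-- The spinor `p` represents the vector `x` under the Hopf map. -/
def IsSpinor (x : Space) (p : ℂ × ℂ) : Prop :=
  ‖x‖ = p.1.re ^ 2 + p.1.im ^ 2 + p.2.re ^ 2 + p.2.im ^ 2 ∧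
    x 0 = 2 * (p.1.re * p.2.re + p.1.im * p.2.im) ∧
    x 1 = 2 * (p.1.re * p.2.im - p.1.im * p.2.re) ∧
    x 2 = p.1.re ^ 2 + p.1.im ^ 2 - p.2.re ^ 2 - p.2.im ^ 2

lemma exists_isSpinor (x : Space) : ∃ p, IsSpinor x p := by
  have hn : ‖x‖ ^ 2 = x 0 ^ 2 + x 1 ^ 2 + x 2 ^ 2 := by
    rw [EuclideanSpace.norm_sq_eq]; simp [Fin.sum_univ_three]
  have h0 : 0 ≤ ‖x‖ := norm_nonneg x
  have hle : -x 2 ≤ ‖x‖ := by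
    by_contra! h
    nlinarith [sq_nonneg (x 0), sq_nonneg (x 1)]
  rcases eq_or_lt_of_le (by linarith : 0 ≤ ‖x‖ + x 2) with h | h
  · have hx : x 2 = -‖x‖ := by linarith
    have h00 : x 0 = 0 := by nlinarith [sq_nonneg (x 0), sq_nonneg (x 1)]
    have h11 : x 1 = 0 := by nlinarith [sq_nonneg (x 0), sq_nonneg (x 1)]
    refine ⟨(0, (√‖x‖ : ℝ)), ?_, ?_, ?_, ?_⟩ <;>
      simp [Real.sq_sqrt h0, h00, h11, hx]
  · have h2 : 0 < 2 * (‖x‖ + x 2) := by linarith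
    set r := √(2 * (‖x‖ + x 2)) with hr
    have hr0 : r ≠ 0 := (Real.sqrt_pos.2 h2).ne'
    have hr2 : r ^ 2 = 2 * (‖x‖ + x 2) := Real.sq_sqrt h2.le
    refine ⟨(((‖x‖ + x 2) / r : ℝ), ⟨x 0 / r, x 1 / r⟩), ?_, ?_, ?_, ?_⟩
    · simp; field_simp; rw [hr2]; linear_combination hn
    · simp; field_simp; rw [hr2]; ring
    · simp; field_simp; rw [hr2]; ring
    · simp; field_simp; rw [hr2]; linear_combination -hn

/-- A spinor representing a vector of `ℝ³` under the Hopf map. -/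
noncomputable def spinor (x : Space) : ℂ × ℂ := (exists_isSpinor x).choose

lemma isSpinor_spinor (x : Space) : IsSpinor x (spinor x) := (exists_isSpinor x).choose_spec

/-- The Hermitian product of the spinors of two vectors. -/
noncomputable def spinorInner (x y : Space) : ℂ :=
  star (spinor x).1 * (spinor y).1 + star (spinor x).2 * (spinor y).2

lemma star_spinorInner (x y : Space) : star (spinorInner x y) = spinorInner y x := by
  simp [spinorInner, mul_comm]

/-- A complex number whose argument is half the solid angle of the geodesic triangle
with vertices in the directions `a`, `b`, `c`. -/
noncomputable def solidAnglePhasor (a b c : Space) : ℂ :=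
  ⟨‖a‖ * ‖b‖ * ‖c‖ + inner ℝ a b * ‖c‖ + inner ℝ b c * ‖a‖ + inner ℝ c a * ‖b‖,
    tripleProduct a b c⟩

lemma solidAnglePhasor_eq (a b c : Space) :
    solidAnglePhasor a b c = 4 * (spinorInner a b * spinorInner b c * spinorInner c a) := by
  have e1 (x y : Space) : inner ℝ x y = x 0 * y 0 + x 1 * y 1 + x 2 * y 2 := by
    simp [PiLp.inner_apply, Fin.sum_univ_three, mul_comm]
  rw [spinorInner, spinorInner, spinorInner]
  have ha := isSpinor_spinor a
  have hb := isSpinor_spinor b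
  have hc := isSpinor_spinor c
  generalize spinor a = p at *
  generalize spinor b = q at *
  generalize spinor c = r at *
  obtain ⟨a1, a2, a3, a4⟩ := ha
  obtain ⟨b1, b2, b3, b4⟩ := hb
  obtain ⟨c1, c2, c3, c4⟩ := hc
  simp only [solidAnglePhasor, e1, tripleProduct, a1, a2, a3, a4, b1, b2, b3, b4, c1, c2, c3, c4]
  apply Complex.ext
  · simp; ring
  · simp; ring

/-- The unit complex number in the direction of `w`. -/
noncomputable def phase (w : ℂ) : ℂ := w / ‖w‖

lemma phase_mul (v w : ℂ) : phase (v * w) = phase v * phase w := by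
  simp [phase, mul_div_mul_comm]

lemma phase_ne_zero {w : ℂ} (hw : w ≠ 0) : phase w ≠ 0 := by
  simp [phase, hw]

lemma phase_star (w : ℂ) : phase (star w) = (phase w)⁻¹ := by
  rcases eq_or_ne w 0 with rfl | hw
  · simp [phase]
  · have : (‖w‖ : ℂ) ≠ 0 := by simpa using hw
    simp only [phase, inv_div, norm_star]
    rw [div_eq_div_iff this hw]
    simpa [mul_comm, sq] using Complex.mul_conj' w

lemma phase_four : phase 4 = 1 := by simp [phase]

lemma exp_arg_eq_phase {w : ℂ} (hw : w ≠ 0) : Complex.exp (w.arg * Complex.I) = phase w := by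
  have : (‖w‖ : ℂ) ≠ 0 := by simpa using hw
  rw [phase, eq_div_iff this, mul_comm, Complex.norm_mul_exp_arg_mul_I]

lemma phase_solidAnglePhasor (a b c : Space) :
    phase (solidAnglePhasor a b c) =
      phase (spinorInner a b) * phase (spinorInner b c) * phase (spinorInner c a) := by
  simp [solidAnglePhasor_eq, phase_mul, phase_four]

lemma spinorInner_ne_zero {a b c : Space} (h : solidAnglePhasor a b c ≠ 0) :
    spinorInner a b ≠ 0 ∧ spinorInner b c ≠ 0 ∧ spinorInner c a ≠ 0 := by
  rw [solidAnglePhasor_eq] at h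
  simp only [mul_ne_zero_iff] at h
  tauto

lemma phase_spinorInner_swap (a b : Space) :
    phase (spinorInner b a) = (phase (spinorInner a b))⁻¹ := by
  rw [← star_spinorInner, phase_star]

/-- Half the solid angle of the quadrilateral `a b c d`, cut along its diagonal `a c`. -/
noncomputable def quadAngle (a b c d : Space) : ℝ :=
  (solidAnglePhasor a b c).arg + (solidAnglePhasor a c d).arg

lemma exp_quadAngle {a b c d : Space} (h₁ : solidAnglePhasor a b c ≠ 0)
    (h₂ : solidAnglePhasor a c d ≠ 0) :
    Complex.exp (quadAngle a b c d * Complex.I) =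
      phase (spinorInner a b) * (phase (spinorInner d c))⁻¹ *
        (phase (spinorInner b c) * (phase (spinorInner a d))⁻¹) := by
  rw [quadAngle, Complex.ofReal_add, add_mul, Complex.exp_add, exp_arg_eq_phase h₁,
    exp_arg_eq_phase h₂, phase_solidAnglePhasor, phase_solidAnglePhasor,
    phase_spinorInner_swap a c, phase_spinorInner_swap d c, phase_spinorInner_swap a d]
  have := phase_ne_zero (spinorInner_ne_zero h₂).1
  field_simp

/-- The product of the phases of the consecutive Hermitian products along a closed polygon. -/
noncomputable def polygonPhase (N : ℕ) (f : ℕ → Space) : ℂ :=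
  ∏ j ∈ Finset.range N, phase (spinorInner (f j) (f (j + 1)))

lemma exp_sum_quadAngle (M N : ℕ) (hM : 0 < M) (F : ℕ → ℕ → Space) (hF : ∀ i, F i N = F i 0)
    (h₁ : ∀ i < M, ∀ j < N,
      solidAnglePhasor (F i j) (F (i + 1) j) (F (i + 1) (j + 1)) ≠ 0)
    (h₂ : ∀ i < M, ∀ j < N,
      solidAnglePhasor (F i j) (F (i + 1) (j + 1)) (F i (j + 1)) ≠ 0) :
    Complex.exp ((∑ i ∈ Finset.range M, ∑ j ∈ Finset.range N,
      quadAngle (F i j) (F (i + 1) j) (F (i + 1) (j + 1)) (F i (j + 1)) : ℝ) * Complex.I) =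
      polygonPhase N (F M) / polygonPhase N (F 0) := by
  have hrow : ∀ i < M, Complex.exp ((∑ j ∈ Finset.range N,
      quadAngle (F i j) (F (i + 1) j) (F (i + 1) (j + 1)) (F i (j + 1)) : ℝ) * Complex.I) =
      polygonPhase N (F (i + 1)) / polygonPhase N (F i) := by
    intro i hi
    rw [Complex.ofReal_sum, Finset.sum_mul, Complex.exp_sum]
    rw [Finset.prod_congr rfl fun j hj => exp_quadAngle (h₁ i hi j (Finset.mem_range.1 hj))
      (h₂ i hi j (Finset.mem_range.1 hj))]
    rw [Finset.prod_mul_distrib, Finset.prod_mul_distrib, Finset.prod_mul_distrib,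
      Finset.prod_inv_distrib, Finset.prod_inv_distrib, polygonPhase, polygonPhase, div_eq_mul_inv]
    have hshift : ∏ j ∈ Finset.range N, phase (spinorInner (F i (j + 1)) (F (i + 1) (j + 1))) =
        ∏ j ∈ Finset.range N, phase (spinorInner (F i j) (F (i + 1) j)) := by
      have h := Finset.prod_range_succ (fun j => phase (spinorInner (F i j) (F (i + 1) j))) N
      rw [Finset.prod_range_succ', hF, hF] at h
      rcases Nat.eq_zero_or_pos N with rfl | hN
      · simp
      · exact mul_right_cancel₀ (phase_ne_zero (spinorInner_ne_zero (h₁ i hi 0 hN)).1) h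
    rw [hshift, mul_inv_cancel₀, one_mul]
    exact Finset.prod_ne_zero_iff.2 fun j hj =>
      phase_ne_zero (spinorInner_ne_zero (h₁ i hi j (Finset.mem_range.1 hj))).1
  have hne : ∀ i < M, polygonPhase N (F i) ≠ 0 := fun i hi =>
    Finset.prod_ne_zero_iff.2 fun j hj => phase_ne_zero fun h0 =>
      (spinorInner_ne_zero (h₂ i hi j (Finset.mem_range.1 hj))).2.2 (by
        rw [← star_spinorInner, h0, star_zero])
  have key : ∀ m ≤ M, Complex.exp ((∑ i ∈ Finset.range m, ∑ j ∈ Finset.range N,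
      quadAngle (F i j) (F (i + 1) j) (F (i + 1) (j + 1)) (F i (j + 1)) : ℝ) * Complex.I) =
      polygonPhase N (F m) / polygonPhase N (F 0) := by
    intro m hm
    induction m with
    | zero => simp [div_self (hne 0 hM)]
    | succ m ih =>
      rw [Finset.sum_range_succ, Complex.ofReal_add, add_mul, Complex.exp_add, ih (by omega),
        hrow m hm]
      have := hne m hm
      field_simp
  exact key M le_rfl

/-! ### The Gauss integral as a limit of sums of solid angles -/

lemma eventually_forall_unitSquare {P : ℝ → ℝ × ℝ → ℝ × ℝ → Prop}
    (h : ∀ p ∈ Set.Icc (0 : ℝ) 1 ×ˢ Set.Icc (0 : ℝ) 1,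
      ∀ᶠ x in (𝓝[>] (0 : ℝ) ×ˢ 𝓝 p) ×ˢ 𝓝 p, P x.1.1 x.1.2 x.2) :
    ∀ᶠ N : ℕ in atTop, ∀ i < N, ∀ j < N, ∀ s ∈ Set.Icc ((i : ℝ) / N) ((i + 1 : ℝ) / N),
      ∀ t ∈ Set.Icc ((j : ℝ) / N) ((j + 1 : ℝ) / N),
        P (1 / (N : ℝ)) ((i : ℝ) / N, (j : ℝ) / N) (s, t) := by
  have hloc : ∀ᶠ x : ℝ × (ℝ × ℝ) in 𝓝 (0, 0), ∀ p ∈ Set.Icc (0 : ℝ) 1 ×ˢ Set.Icc (0 : ℝ) 1,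
      0 < x.1 → P x.1 p (p + x.2) := by
    refine IsCompact.eventually_forall_of_forall_eventually (isCompact_Icc.prod isCompact_Icc)
      fun p hp => ?_
    have h1 : Tendsto (fun z : (ℝ × (ℝ × ℝ)) × (ℝ × ℝ) => ((z.1.1, z.2), z.2 + z.1.2))
        (𝓝 ((0, 0), p) ⊓ 𝓟 {z | 0 < z.1.1}) ((𝓝[>] (0 : ℝ) ×ˢ 𝓝 p) ×ˢ 𝓝 p) := by
      refine (Tendsto.prodMk ?_ ?_).prodMk ?_
      · refine tendsto_inf.2 ⟨tendsto_inf_left ?_, tendsto_inf_right ?_⟩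
        · exact (continuous_fst.comp continuous_fst).tendsto' _ _ rfl
        · exact tendsto_principal_principal.2 fun z hz => hz
      · exact tendsto_inf_left (continuous_snd.tendsto' _ _ rfl)
      · exact tendsto_inf_left (Continuous.tendsto' (by fun_prop) _ _ (by simp))
    exact eventually_inf_principal.1 (h1.eventually (h p hp))
  obtain ⟨r, hr, hball⟩ := Metric.eventually_nhds_iff.1 hloc
  filter_upwards [tendsto_one_div_atTop_nhds_zero_nat.eventually (gt_mem_nhds hr),
    eventually_gt_atTop 0] with N hNr hN0 i hi j hj s hs t ht
  have hN : (0 : ℝ) < N := by exact_mod_cast hN0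
  have hi1 : (i : ℝ) ≤ N := by exact_mod_cast hi.le
  have hj1 : (j : ℝ) ≤ N := by exact_mod_cast hj.le
  have hpos : 0 < 1 / (N : ℝ) := by positivity
  rw [add_div] at hs ht
  have := hball (y := (1 / (N : ℝ), (s - i / N, t - j / N))) (by
      simp only [Prod.dist_eq, Real.dist_eq, sub_zero, Prod.fst_zero, Prod.snd_zero]
      refine max_lt ?_ (max_lt ?_ ?_)
      · rwa [abs_of_pos hpos]
      · rw [abs_of_nonneg (by linarith [hs.1])]; linarith [hs.2]
      · rw [abs_of_nonneg (by linarith [ht.1])]; linarith [ht.2])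
    (i / N, j / N) ⟨⟨by positivity, (div_le_one hN).2 hi1⟩, by positivity, (div_le_one hN).2 hj1⟩
    hpos
  simpa using this

/-- A Riemann-sum statement on the unit square for summands that converge locally uniformly
to a continuous integrand as the mesh tends to zero. -/
lemma tendsto_sum_grid (f : ℝ → ℝ × ℝ → ℝ) (g : ℝ × ℝ → ℝ) (hg : Continuous g)
    (h : ∀ p ∈ Set.Icc (0 : ℝ) 1 ×ˢ Set.Icc (0 : ℝ) 1,
      Tendsto (Function.uncurry f) (𝓝[>] 0 ×ˢ 𝓝 p) (𝓝 (g p))) :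
    Tendsto (fun N : ℕ => ∑ i ∈ Finset.range N, ∑ j ∈ Finset.range N,
        (1 / (N : ℝ)) ^ 2 * f (1 / (N : ℝ)) (i / N, j / N)) atTop
      (𝓝 (∫ s in (0 : ℝ)..1, ∫ t in (0 : ℝ)..1, g (s, t))) := by
  rw [Metric.tendsto_nhds]
  intro ε hε
  have hcell := eventually_forall_unitSquare (P := fun x p q => |f x p - g q| ≤ ε / 2) (by
    intro p hp
    have h1 : Tendsto (fun x : (ℝ × (ℝ × ℝ)) × (ℝ × ℝ) => f x.1.1 x.1.2 - g x.2)
        ((𝓝[>] (0 : ℝ) ×ˢ 𝓝 p) ×ˢ 𝓝 p) (𝓝 (g p - g p)) :=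
      ((h p hp).comp tendsto_fst).sub ((hg.tendsto p).comp tendsto_snd)
    rw [sub_self] at h1
    filter_upwards [Metric.tendsto_nhds.1 h1 (ε / 2) (by positivity)] with x hx
    simpa using hx.le)
  filter_upwards [hcell, eventually_gt_atTop 0] with N hN hN0
  have hNpos : (0 : ℝ) < N := by exact_mod_cast hN0
  have hInt : ∀ s a b : ℝ, IntervalIntegrable (fun t => g (s, t)) MeasureTheory.volume a b :=
    fun s a b => (Continuous.intervalIntegrable (by fun_prop) _ _)
  have hint2 : ∀ a b c d : ℝ, IntervalIntegrable (fun s => ∫ t in c..d, g (s, t))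
      MeasureTheory.volume a b := fun a b c d =>
    (intervalIntegral.continuous_parametric_intervalIntegral_of_continuous'
      (f := fun s t => g (s, t)) (by exact hg) c d).intervalIntegrable _ _
  have hsum : ∀ φ : ℝ → ℝ, (∀ a b, IntervalIntegrable φ MeasureTheory.volume a b) →
      ∫ t in (0 : ℝ)..1, φ t = ∑ j ∈ Finset.range N, ∫ t in (j / N : ℝ)..((j + 1) / N : ℝ), φ t := by
    intro φ hφ
    have := intervalIntegral.sum_integral_adjacent_intervals (μ := MeasureTheory.volume)
      (f := φ) (a := fun k : ℕ => (k / N : ℝ)) (n := N) fun k _ => hφ _ _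
    simp only [Nat.cast_add, Nat.cast_one, Nat.cast_zero, zero_div, div_self hNpos.ne'] at this
    exact this.symm
  have htot : ∫ s in (0 : ℝ)..1, ∫ t in (0 : ℝ)..1, g (s, t) =
      ∑ i ∈ Finset.range N, ∑ j ∈ Finset.range N, ∫ s in (i / N : ℝ)..((i + 1) / N : ℝ),
        ∫ t in (j / N : ℝ)..((j + 1) / N : ℝ), g (s, t) := by
    rw [hsum _ fun a b => hint2 a b 0 1]
    refine Finset.sum_congr rfl fun i _ => ?_
    rw [← intervalIntegral.integral_finsetSum fun j _ => hint2 _ _ _ _]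
    exact intervalIntegral.integral_congr fun s _ => hsum _ (hInt s)
  rw [htot, Real.dist_eq, ← Finset.sum_sub_distrib]
  have hlen : ∀ k : ℕ, ((k + 1) / N : ℝ) - k / N = 1 / N := fun k => by ring
  have hle : ∀ k : ℕ, (k / N : ℝ) ≤ (k + 1) / N := fun k => by gcongr; linarith
  have hbound : ∀ i < N, ∀ j < N, |(1 / (N : ℝ)) ^ 2 * f (1 / (N : ℝ)) (i / N, j / N) -
      ∫ s in (i / N : ℝ)..((i + 1) / N : ℝ), ∫ t in (j / N : ℝ)..((j + 1) / N : ℝ), g (s, t)|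
      ≤ ε / 2 * (1 / N) * (1 / N) := by
    intro i hi j hj
    have e : (1 / (N : ℝ)) ^ 2 * f (1 / (N : ℝ)) (i / N, j / N) =
        ∫ s in (i / N : ℝ)..((i + 1) / N : ℝ), ∫ t in (j / N : ℝ)..((j + 1) / N : ℝ),
          f (1 / (N : ℝ)) (i / N, j / N) := by
      simp only [intervalIntegral.integral_const, hlen, smul_eq_mul]; ring
    rw [e, ← intervalIntegral.integral_sub (by simp) (hint2 _ _ _ _), ← Real.norm_eq_abs]
    refine (intervalIntegral.norm_integral_le_of_norm_le_const
      (C := ε / 2 * (1 / N)) fun s hs => ?_).trans_eq ?_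
    · rw [← intervalIntegral.integral_sub (by simp) (hInt _ _ _)]
      refine (intervalIntegral.norm_integral_le_of_norm_le_const (C := ε / 2)
        fun t ht => ?_).trans_eq ?_
      · rw [Set.uIoc_of_le (hle _)] at hs ht
        exact hN i hi j hj s ⟨hs.1.le, hs.2⟩ t ⟨ht.1.le, ht.2⟩
      · rw [hlen, abs_of_pos (by positivity)]
    · rw [hlen, abs_of_pos (by positivity)]
  calc _ ≤ ∑ i ∈ Finset.range N, ∑ j ∈ Finset.range N, ε / 2 * (1 / N) * (1 / N) := by
        refine (Finset.abs_sum_le_sum_abs _ _).trans (Finset.sum_le_sum fun i hi => ?_)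
        rw [← Finset.sum_sub_distrib]
        refine (Finset.abs_sum_le_sum_abs _ _).trans (Finset.sum_le_sum fun j hj => ?_)
        exact hbound i (Finset.mem_range.1 hi) j (Finset.mem_range.1 hj)
    _ = ε / 2 := by simp; field_simp
    _ < ε := by linarith

/-- The curves `γ`, `c` are continuously differentiable and disjoint. -/
structure DisjointCurves (γ c : ℝ → Space) : Prop where
  left : ContDiff ℝ 1 γ
  right : ContDiff ℝ 1 c
  ne : ∀ s t, γ s ≠ c t

lemma continuous_tripleProduct {X : Type*} [TopologicalSpace X] {a b x : X → Space}
    (ha : Continuous a) (hb : Continuous b) (hx : Continuous x) :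
    Continuous fun p => tripleProduct (a p) (b p) (x p) := by
  unfold tripleProduct; fun_prop

lemma tendsto_tripleProduct {X : Type*} {l : Filter X} {a b x : X → Space}
    {a₀ b₀ x₀ : Space} (ha : Tendsto a l (𝓝 a₀)) (hb : Tendsto b l (𝓝 b₀))
    (hx : Tendsto x l (𝓝 x₀)) :
    Tendsto (fun p => tripleProduct (a p) (b p) (x p)) l (𝓝 (tripleProduct a₀ b₀ x₀)) := by
  have : Continuous fun q : Space × Space × Space => tripleProduct q.1 q.2.1 q.2.2 :=
    continuous_tripleProduct (by fun_prop) (by fun_prop) (by fun_prop)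
  exact (this.tendsto (a₀, b₀, x₀)).comp (ha.prodMk_nhds (hb.prodMk_nhds hx))

lemma DisjointCurves.continuous_integrand {γ c : ℝ → Space} (h : DisjointCurves γ c) :
    Continuous fun p : ℝ × ℝ => gaussLinkingIntegrand γ c p.1 p.2 := by
  have h1 := h.left.continuous_deriv le_rfl
  have h2 := h.right.continuous_deriv le_rfl
  have h3 := h.left.continuous
  have h4 := h.right.continuous
  simp only [gaussLinkingIntegrand_eq]
  refine (continuous_tripleProduct (by fun_prop) (by fun_prop) (by fun_prop)).div (by fun_prop)
    fun p => ?_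
  exact pow_ne_zero _ (norm_ne_zero_iff.2 (sub_ne_zero.2 (h.ne _ _)))

/-- The difference quotient of a `C¹` curve converges locally uniformly. -/
lemma ContDiff.tendsto_slope {γ : ℝ → Space} (h : ContDiff ℝ 1 γ) (s : ℝ) :
    Tendsto (fun x : ℝ × ℝ => x.1⁻¹ • (γ (x.2 + x.1) - γ x.2)) (𝓝[>] 0 ×ˢ 𝓝 s)
      (𝓝 (deriv γ s)) := by
  have hs : HasStrictDerivAt γ (deriv γ s) s := h.contDiffAt.hasStrictDerivAt one_ne_zero
  have ho := hs.hasStrictFDerivAt.isLittleO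
  have ht : Tendsto (fun x : ℝ × ℝ => (x.2 + x.1, x.2)) (𝓝[>] 0 ×ˢ 𝓝 s) (𝓝 (s, s)) := by
    have : Tendsto (fun x : ℝ × ℝ => (x.2 + x.1, x.2)) (𝓝 (0, s)) (𝓝 (s, s)) :=
      Continuous.tendsto' (by fun_prop) _ _ (by simp)
    rw [nhds_prod_eq] at this
    exact this.mono_left (prod_mono_left _ nhdsWithin_le_nhds)
  have ho' := ho.comp_tendsto ht
  rw [tendsto_iff_norm_sub_tendsto_zero]
  have hdiv := ho'.norm_left.norm_right.tendsto_div_nhds_zero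
  refine hdiv.congr' ?_
  have hpos : ∀ᶠ x : ℝ × ℝ in 𝓝[>] 0 ×ˢ 𝓝 s, 0 < x.1 :=
    (eventually_mem_nhdsWithin (a := (0 : ℝ)) (s := Set.Ioi 0)).prod_inl _
  filter_upwards [hpos] with x hx
  simp only [Function.comp, add_sub_cancel_left, ContinuousLinearMap.toSpanSingleton_apply]
  rw [div_eq_inv_mul, ← norm_inv, ← norm_smul, smul_sub, smul_smul, inv_mul_cancel₀ hx.ne',
    one_smul]

lemma tendsto_arg_div_sq {X : Type*} {l : Filter X} {z : X → ℂ} {ρ : X → ℝ} {r m : ℝ}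
    (hr : 0 < r) (hz : Tendsto z l (𝓝 r))
    (him : Tendsto (fun x => (z x).im / ρ x) l (𝓝 m)) :
    Tendsto (fun x => (z x).arg / ρ x) l (𝓝 (m / r)) := by
  have hre : Tendsto (fun x => (z x).re) l (𝓝 r) := by
    simpa [Function.comp_def] using (Complex.continuous_re.tendsto _).comp hz
  have hnorm : Tendsto (fun x => ‖z x‖) l (𝓝 r) := by
    simpa [abs_of_pos hr] using hz.norm
  have him0 : Tendsto (fun x => (z x).im / ‖z x‖) l (𝓝 0) := by
    have : Tendsto (fun x => (z x).im) l (𝓝 0) := by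
      simpa [Function.comp_def] using (Complex.continuous_im.tendsto _).comp hz
    have h := this.div hnorm hr.ne'
    rw [zero_div] at h
    exact h
  have hd : Tendsto (dslope Real.arcsin 0) (𝓝 0) (𝓝 1) := by
    have h1 : HasDerivAt Real.arcsin 1 0 := by
      simpa using Real.hasDerivAt_arcsin (x := 0) (by norm_num) (by norm_num)
    have := (continuousAt_dslope_same.2 h1.differentiableAt).tendsto
    rwa [dslope_same, h1.deriv] at this
  have hdiv : Tendsto (fun x => (z x).im / ρ x / ‖z x‖) l (𝓝 (m / r)) := him.div hnorm hr.ne'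
  have hlim := (hd.comp him0).mul hdiv
  rw [one_mul] at hlim
  refine hlim.congr' ?_
  filter_upwards [hre.eventually (lt_mem_nhds hr)] with x hx
  have := sub_smul_dslope Real.arcsin 0 ((z x).im / ‖z x‖)
  simp only [sub_zero, smul_eq_mul, Real.arcsin_zero] at this
  simp only [Function.comp, Complex.arg_of_re_nonneg hx.le, ← this]
  ring

lemma tripleProduct_smul_left (a x y : Space) (r : ℝ) :
    tripleProduct a (r • x) (r • y) = r ^ 2 * tripleProduct a x y := by
  simp [tripleProduct]; ring

lemma solidAnglePhasor_self (a : Space) : solidAnglePhasor a a a = ((4 * ‖a‖ ^ 3 : ℝ) : ℂ) := by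
  apply Complex.ext
  · simp [solidAnglePhasor, -Complex.ofReal_mul, -Complex.ofReal_pow]; ring
  · simp [solidAnglePhasor, tripleProduct, -Complex.ofReal_mul, -Complex.ofReal_pow]; ring

lemma tendsto_solidAnglePhasor {X : Type*} {l : Filter X} {a b c : X → Space}
    {a₀ b₀ c₀ : Space} (ha : Tendsto a l (𝓝 a₀)) (hb : Tendsto b l (𝓝 b₀))
    (hc : Tendsto c l (𝓝 c₀)) :
    Tendsto (fun p => solidAnglePhasor (a p) (b p) (c p)) l
      (𝓝 (solidAnglePhasor a₀ b₀ c₀)) := by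
  have h1 : Continuous fun q : Space × Space × Space =>
      solidAnglePhasor q.1 q.2.1 q.2.2 := by
    have h2 : Continuous fun q : Space × Space × Space => tripleProduct q.1 q.2.1 q.2.2 :=
      continuous_tripleProduct (by fun_prop) (by fun_prop) (by fun_prop)
    refine Complex.equivRealProdCLM.symm.continuous.comp (.prodMk ?_ h2)
    fun_prop
  exact Tendsto.comp (f := fun p => (a p, b p, c p)) (h1.tendsto (a₀, b₀, c₀)) (ha.prodMk_nhds (hb.prodMk_nhds hc))

lemma im_solidAnglePhasor_left (a b c d : Space) :
    (solidAnglePhasor (a - c) (b - c) (b - d)).im = tripleProduct (a - c) (b - a) (-(d - c)) := by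
  simp only [solidAnglePhasor, tripleProduct, PiLp.sub_apply, PiLp.neg_apply]; ring

lemma im_solidAnglePhasor_right (a b c d : Space) :
    (solidAnglePhasor (a - c) (b - d) (a - d)).im = tripleProduct (a - c) (b - a) (-(d - c)) := by
  simp only [solidAnglePhasor, tripleProduct, PiLp.sub_apply, PiLp.neg_apply]; ring

namespace DisjointCurves

variable {γ c : ℝ → Space}

/-- The vertex displacements of a small grid cell. -/
lemma tendsto_cell (h : DisjointCurves γ c) (p : ℝ × ℝ) :
    Tendsto (fun x : ℝ × ℝ × ℝ => γ x.2.1 - c x.2.2) (𝓝[>] 0 ×ˢ 𝓝 p) (𝓝 (γ p.1 - c p.2)) ∧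
    Tendsto (fun x : ℝ × ℝ × ℝ => γ (x.2.1 + x.1) - c x.2.2) (𝓝[>] 0 ×ˢ 𝓝 p)
      (𝓝 (γ p.1 - c p.2)) ∧
    Tendsto (fun x : ℝ × ℝ × ℝ => γ (x.2.1 + x.1) - c (x.2.2 + x.1)) (𝓝[>] 0 ×ˢ 𝓝 p)
      (𝓝 (γ p.1 - c p.2)) ∧
    Tendsto (fun x : ℝ × ℝ × ℝ => γ x.2.1 - c (x.2.2 + x.1)) (𝓝[>] 0 ×ˢ 𝓝 p)
      (𝓝 (γ p.1 - c p.2)) := by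
  have hγ := h.left.continuous
  have hc := h.right.continuous
  have hle : 𝓝[>] (0 : ℝ) ×ˢ 𝓝 p ≤ 𝓝 (0, p) := by
    rw [nhds_prod_eq (x := (0 : ℝ)) (y := p)]; exact prod_mono_left _ nhdsWithin_le_nhds
  refine ⟨?_, ?_, ?_, ?_⟩ <;>
    exact Tendsto.mono_left (Continuous.tendsto' (by fun_prop) _ _ (by simp)) hle

lemma tendsto_quadAngle (h : DisjointCurves γ c) (p : ℝ × ℝ) :
    Tendsto (fun x : ℝ × ℝ × ℝ => quadAngle (γ x.2.1 - c x.2.2) (γ (x.2.1 + x.1) - c x.2.2)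
        (γ (x.2.1 + x.1) - c (x.2.2 + x.1)) (γ x.2.1 - c (x.2.2 + x.1)) / x.1 ^ 2)
      (𝓝[>] 0 ×ˢ 𝓝 p) (𝓝 (-(1 / 2) * gaussLinkingIntegrand γ c p.1 p.2)) := by
  obtain ⟨hA, hB, hC, hD⟩ := h.tendsto_cell p
  have hpos : 0 < ‖γ p.1 - c p.2‖ := norm_pos_iff.2 (sub_ne_zero.2 (h.ne _ _))
  have hγ : Tendsto (fun x : ℝ × ℝ × ℝ => x.1⁻¹ • (γ (x.2.1 + x.1) - γ x.2.1)) (𝓝[>] 0 ×ˢ 𝓝 p)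
      (𝓝 (deriv γ p.1)) :=
    Tendsto.comp (f := fun x : ℝ × ℝ × ℝ => (x.1, x.2.1)) (h.left.tendsto_slope p.1)
      (tendsto_fst.prodMk ((continuous_fst.tendsto p).comp tendsto_snd))
  have hc : Tendsto (fun x : ℝ × ℝ × ℝ => x.1⁻¹ • (c (x.2.2 + x.1) - c x.2.2)) (𝓝[>] 0 ×ˢ 𝓝 p)
      (𝓝 (deriv c p.2)) :=
    Tendsto.comp (f := fun x : ℝ × ℝ × ℝ => (x.1, x.2.2)) (h.right.tendsto_slope p.2)
      (tendsto_fst.prodMk ((continuous_snd.tendsto p).comp tendsto_snd))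
  have hT := tendsto_tripleProduct hA hγ hc.neg
  have hT' : Tendsto (fun x : ℝ × ℝ × ℝ => tripleProduct (γ x.2.1 - c x.2.2)
      (γ (x.2.1 + x.1) - γ x.2.1) (-(c (x.2.2 + x.1) - c x.2.2)) / x.1 ^ 2) (𝓝[>] 0 ×ˢ 𝓝 p)
      (𝓝 (tripleProduct (γ p.1 - c p.2) (deriv γ p.1) (-deriv c p.2))) := by
    refine hT.congr fun x => ?_
    rw [← smul_neg, tripleProduct_smul_left, inv_pow, div_eq_inv_mul]
  have hz1 := tendsto_solidAnglePhasor hA hB hC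
  have hz2 := tendsto_solidAnglePhasor hA hC hD
  rw [solidAnglePhasor_self] at hz1 hz2
  have hr : 0 < 4 * ‖γ p.1 - c p.2‖ ^ 3 := by positivity
  have h1 := tendsto_arg_div_sq (ρ := fun x => x.1 ^ 2) hr hz1
    (hT'.congr fun x => by rw [im_solidAnglePhasor_left])
  have h2 := tendsto_arg_div_sq (ρ := fun x => x.1 ^ 2) hr hz2
    (hT'.congr fun x => by rw [im_solidAnglePhasor_right])
  have e : -(1 / 2) * gaussLinkingIntegrand γ c p.1 p.2 =
      tripleProduct (γ p.1 - c p.2) (deriv γ p.1) (-deriv c p.2) / (4 * ‖γ p.1 - c p.2‖ ^ 3) +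
      tripleProduct (γ p.1 - c p.2) (deriv γ p.1) (-deriv c p.2) / (4 * ‖γ p.1 - c p.2‖ ^ 3) := by
    rw [gaussLinkingIntegrand_eq]
    simp only [tripleProduct, PiLp.sub_apply, PiLp.neg_apply]
    ring
  rw [e]
  refine (h1.add h2).congr fun x => ?_
  rw [quadAngle, add_div]

/-- If `c` is closed, the Gauss integral of a path `γ` with `c` is, modulo integers, a limit of
phases that depend only on the endpoints of `γ`. -/
lemma tendsto_polygonPhase (h : DisjointCurves γ c) (hc : c 1 = c 0) :
    Tendsto (fun N : ℕ => polygonPhase N (fun j => γ 1 - c (j / N)) /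
        polygonPhase N (fun j => γ 0 - c (j / N))) atTop
      (𝓝 (Complex.exp (-(2 * Real.pi * linkingNumber γ c * Complex.I)))) := by
  have hlim := tendsto_sum_grid
    (fun x p => quadAngle (γ p.1 - c p.2) (γ (p.1 + x) - c p.2)
      (γ (p.1 + x) - c (p.2 + x)) (γ p.1 - c (p.2 + x)) / x ^ 2)
    (fun p => -(1 / 2) * gaussLinkingIntegrand γ c p.1 p.2)
    (continuous_const.mul h.continuous_integrand) fun p _ => h.tendsto_quadAngle p
  have hval : ∫ s in (0 : ℝ)..1, ∫ t in (0 : ℝ)..1, -(1 / 2) * gaussLinkingIntegrand γ c s t =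
      -(2 * Real.pi * linkingNumber γ c) := by
    simp only [intervalIntegral.integral_const_mul, linkingNumber]
    field_simp
    ring
  rw [hval] at hlim
  have hexp : Continuous fun x : ℝ => Complex.exp (x * Complex.I) := by fun_prop
  have hlim' := (hexp.tendsto _).comp hlim
  have hne := eventually_forall_unitSquare (P := fun x p _ =>
      solidAnglePhasor (γ p.1 - c p.2) (γ (p.1 + x) - c p.2) (γ (p.1 + x) - c (p.2 + x)) ≠ 0 ∧
      solidAnglePhasor (γ p.1 - c p.2) (γ (p.1 + x) - c (p.2 + x)) (γ p.1 - c (p.2 + x)) ≠ 0) (by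
    intro p _
    obtain ⟨hA, hB, hC, hD⟩ := h.tendsto_cell p
    have hpos : 0 < ‖γ p.1 - c p.2‖ := norm_pos_iff.2 (sub_ne_zero.2 (h.ne _ _))
    have h0 : solidAnglePhasor (γ p.1 - c p.2) (γ p.1 - c p.2) (γ p.1 - c p.2) ≠ 0 := by
      rw [solidAnglePhasor_self]; exact_mod_cast (by positivity : 4 * ‖γ p.1 - c p.2‖ ^ 3 ≠ 0)
    have h1 := (tendsto_solidAnglePhasor hA hB hC).eventually_ne h0
    have h2 := (tendsto_solidAnglePhasor hA hC hD).eventually_ne h0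
    exact tendsto_fst.eventually (h1.and h2))
  have he : Complex.exp (-(2 * Real.pi * linkingNumber γ c * Complex.I)) =
      Complex.exp ((-(2 * Real.pi * linkingNumber γ c) : ℝ) * Complex.I) := by
    push_cast; ring_nf
  rw [he]
  refine hlim'.congr' ?_
  filter_upwards [hne, eventually_gt_atTop 0] with N hN hN0
  have hNne : (N : ℝ) ≠ 0 := by exact_mod_cast hN0.ne'
  have hstep : ∀ i : ℕ, (i / N + 1 / N : ℝ) = (i + 1 : ℕ) / N := fun i => by push_cast; ring
  have hmem : ∀ i : ℕ, (i / N : ℝ) ∈ Set.Icc (i / N : ℝ) ((i + 1) / N) := fun i =>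
    ⟨le_rfl, by gcongr; linarith⟩
  have key := exp_sum_quadAngle N N hN0 (fun i j => γ (i / N) - c (j / N))
    (fun i => by simp [div_self hNne, hc])
    (fun i hi j hj => by
      have := (hN i hi j hj _ (hmem i) _ (hmem j)).1
      simpa only [hstep] using this)
    (fun i hi j hj => by
      have := (hN i hi j hj _ (hmem i) _ (hmem j)).2
      simpa only [hstep] using this)
  simp only [div_self hNne, Nat.cast_zero, zero_div] at key
  rw [← key, Function.comp]
  refine congrArg (fun x : ℝ => Complex.exp (x * Complex.I))
    (Finset.sum_congr rfl fun i _ => Finset.sum_congr rfl fun j _ => ?_)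
  simp only [hstep]
  field_simp

end DisjointCurves

lemma exists_int_of_exp_eq_one {x : ℝ}
    (h : Complex.exp (-(2 * Real.pi * x * Complex.I)) = 1) : ∃ n : ℤ, x = n := by
  obtain ⟨n, hn⟩ := Complex.exp_eq_one_iff.1 h
  refine ⟨-n, ?_⟩
  have hpi : (Real.pi : ℂ) ≠ 0 := by exact_mod_cast Real.pi_ne_zero
  have : (x : ℂ) = -n := by
    have hI := Complex.I_ne_zero
    have h2 : (2 * Real.pi * Complex.I) * (x + n) = 0 := by linear_combination -hn
    rcases mul_eq_zero.1 h2 with h3 | h3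
    · simp [hpi] at h3
    · linear_combination h3
  exact_mod_cast this

/-- The Gauss integrals of the two halves of a closed path add up to an integer. -/
lemma linkingNumber_add_mem_int {γ₁ γ₂ c : ℝ → Space} (h₁ : DisjointCurves γ₁ c)
    (h₂ : DisjointCurves γ₂ c) (hc : c 1 = c 0) (h12 : γ₁ 1 = γ₂ 0) (h21 : γ₂ 1 = γ₁ 0) :
    ∃ n : ℤ, linkingNumber γ₁ c + linkingNumber γ₂ c = n := by
  have l1 := h₁.tendsto_polygonPhase hc
  have l2 := h₂.tendsto_polygonPhase hc
  apply exists_int_of_exp_eq_one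
  have l := l1.mul l2
  rw [← Complex.exp_add] at l
  have e : -(2 * Real.pi * ((linkingNumber γ₁ c + linkingNumber γ₂ c : ℝ) : ℂ) * Complex.I) =
      -(2 * Real.pi * linkingNumber γ₁ c * Complex.I) +
        -(2 * Real.pi * linkingNumber γ₂ c * Complex.I) := by
    push_cast; ring
  rw [e]
  refine tendsto_nhds_unique l (tendsto_const_nhds.congr' ?_)
  filter_upwards [l.eventually_ne (Complex.exp_ne_zero _)] with N hN
  simp only [h12, h21, ne_eq, mul_eq_zero, div_eq_zero_iff, not_or] at hN ⊢
  obtain ⟨⟨h3, h4⟩, -, -⟩ := hN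
  field_simp

/-- The Gauss linking integral of two disjoint closed curves is an integer. -/
lemma linkingNumber_mem_int {γ c : ℝ → Space} (h : DisjointCurves γ c) (hc : c 1 = c 0)
    (hγ : γ 1 = γ 0) : ∃ n : ℤ, linkingNumber γ c = n := by
  have l := h.tendsto_polygonPhase hc
  apply exists_int_of_exp_eq_one
  refine tendsto_nhds_unique l (tendsto_const_nhds.congr' ?_)
  filter_upwards [l.eventually_ne (Complex.exp_ne_zero _)] with N hN
  rw [hγ] at hN ⊢
  rw [div_self (fun h0 => hN (by rw [h0, div_zero]))]

/-! ### Homotopy invariance and multiple traversal -/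

lemma ContDiff.deriv_slice {Γ : ℝ × ℝ → Space} (hΓ : ContDiff ℝ 1 Γ) (r s : ℝ) :
    deriv (fun s => Γ (r, s)) s = fderiv ℝ Γ (r, s) (0, 1) := by
  have h := (hΓ.differentiable one_ne_zero (r, s)).hasFDerivAt
  have h2 : HasDerivAt (fun s : ℝ => (r, s)) ((0 : ℝ), (1 : ℝ)) s :=
    (hasDerivAt_const s r).prodMk (hasDerivAt_id s)
  exact (h.comp_hasDerivAt s h2).deriv

lemma continuousOn_linkingNumber {Γ C : ℝ × ℝ → Space} (hΓ : ContDiff ℝ 1 Γ) (hC : ContDiff ℝ 1 C)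
    {S : Set ℝ} (hne : ∀ r ∈ S, ∀ s t, Γ (r, s) ≠ C (r, t)) :
    ContinuousOn (fun r => linkingNumber (fun s => Γ (r, s)) (fun t => C (r, t))) S := by
  rw [continuousOn_iff_continuous_domRestrict]
  have hG : Continuous fun x : (S × ℝ) × ℝ =>
      gaussLinkingIntegrand (fun s => Γ (x.1.1, s)) (fun t => C (x.1.1, t)) x.1.2 x.2 := by
    have h1 := hΓ.continuous_fderiv one_ne_zero
    have h2 := hC.continuous_fderiv one_ne_zero
    have h3 := hΓ.continuous
    have h4 := hC.continuous
    simp only [gaussLinkingIntegrand_eq, hΓ.deriv_slice, hC.deriv_slice]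
    refine (continuous_tripleProduct (by fun_prop) (by fun_prop) (by fun_prop)).div (by fun_prop)
      fun x => ?_
    exact pow_ne_zero _ (norm_ne_zero_iff.2 (sub_ne_zero.2 (hne _ x.1.1.2 _ _)))
  have hI : Continuous fun x : S × ℝ => ∫ t in (0 : ℝ)..1,
      gaussLinkingIntegrand (fun s => Γ (x.1, s)) (fun t => C (x.1, t)) x.2 t :=
    intervalIntegral.continuous_parametric_intervalIntegral_of_continuous'
      (f := fun (x : S × ℝ) t =>
        gaussLinkingIntegrand (fun s => Γ (x.1, s)) (fun t => C (x.1, t)) x.2 t) hG 0 1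
  exact continuous_const.mul
    (intervalIntegral.continuous_parametric_intervalIntegral_of_continuous'
      (f := fun (r : S) s => ∫ t in (0 : ℝ)..1,
        gaussLinkingIntegrand (fun s => Γ (r, s)) (fun t => C (r, t)) s t) hI 0 1)

lemma ContinuousOn.eq_of_int_valued {f : ℝ → ℝ} {a b : ℝ} (hf : ContinuousOn f (Set.uIcc a b))
    (hInt : ∀ r ∈ Set.uIcc a b, ∃ n : ℤ, f r = n) : f a = f b := by
  choose! n hn using hInt
  have hc : ContinuousOn n (Set.uIcc a b) := by
    rw [Int.isClosedEmbedding_coe_real.isInducing.continuousOn_iff]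
    exact hf.congr fun r hr => (hn r hr).symm
  have := (isPreconnected_uIcc (a := a) (b := b)).constant hc Set.left_mem_uIcc Set.right_mem_uIcc
  rw [hn a Set.left_mem_uIcc, hn b Set.right_mem_uIcc, this]

lemma disjointCurves_slice {Γ C : ℝ × ℝ → Space} (hΓ : ContDiff ℝ 1 Γ) (hC : ContDiff ℝ 1 C)
    {r : ℝ} (hne : ∀ s t, Γ (r, s) ≠ C (r, t)) :
    DisjointCurves (fun s => Γ (r, s)) (fun t => C (r, t)) :=
  ⟨hΓ.comp (contDiff_prodMk_right r), hC.comp (contDiff_prodMk_right r), hne⟩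

/-- The linking number is unchanged along a homotopy of disjoint closed curves. -/
lemma linkingNumber_eq_of_homotopy {Γ C : ℝ × ℝ → Space} (hΓ : ContDiff ℝ 1 Γ)
    (hC : ContDiff ℝ 1 C) {a b : ℝ}
    (hne : ∀ r ∈ Set.uIcc a b, ∀ s t, Γ (r, s) ≠ C (r, t))
    (hΓ1 : ∀ r, Γ (r, 1) = Γ (r, 0)) (hC1 : ∀ r, C (r, 1) = C (r, 0)) :
    linkingNumber (fun s => Γ (a, s)) (fun t => C (a, t)) =
      linkingNumber (fun s => Γ (b, s)) (fun t => C (b, t)) :=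
  (continuousOn_linkingNumber hΓ hC hne).eq_of_int_valued fun r hr =>
    linkingNumber_mem_int (disjointCurves_slice hΓ hC (hne r hr)) (hC1 r) (hΓ1 r)

lemma Function.Periodic.integral_comp_two_mul {F : ℝ → ℝ} (hF : Continuous F)
    (hp : Function.Periodic F 1) :
    ∫ s in (0 : ℝ)..1, 2 * F (2 * s) = 2 * ∫ s in (0 : ℝ)..1, F s := by
  have h1 := intervalIntegral.smul_integral_comp_mul_left (a := 0) (b := 1) F 2
  have h2 := intervalIntegral.integral_add_adjacent_intervals (μ := MeasureTheory.volume) (f := F)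
    (hF.intervalIntegrable 0 1) (hF.intervalIntegrable 1 2)
  have h3 := hp.intervalIntegral_add_eq 1 0
  simp only [smul_eq_mul, mul_zero, mul_one] at h1
  norm_num at h3
  rw [intervalIntegral.integral_const_mul, h1, ← h2, h3]
  ring

lemma Function.Periodic.deriv {E : Type*} [NormedAddCommGroup E] [NormedSpace ℝ E] {f : ℝ → E}
    {p : ℝ} (h : Function.Periodic f p) : Function.Periodic (deriv f) p := fun s => by
  rw [← deriv_comp_add_const f p s]
  exact congrArg (fun g => _root_.deriv g s) (funext h)

lemma gaussLinkingIntegrand_comp_left (γ c : ℝ → Space) (s t : ℝ) :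
    gaussLinkingIntegrand (fun s => γ (2 * s)) c s t =
      2 * gaussLinkingIntegrand γ c (2 * s) t := by
  simp only [gaussLinkingIntegrand_eq, deriv_comp_mul_left, tripleProduct, PiLp.smul_apply,
    smul_eq_mul]
  ring

lemma gaussLinkingIntegrand_comp_right (γ c : ℝ → Space) (s t : ℝ) :
    gaussLinkingIntegrand γ (fun t => c (2 * t)) s t =
      2 * gaussLinkingIntegrand γ c s (2 * t) := by
  simp only [gaussLinkingIntegrand_eq, deriv_comp_mul_left, tripleProduct, PiLp.smul_apply,
    smul_eq_mul]
  ring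

/-- Traversing the first curve twice doubles the linking number. -/
lemma DisjointCurves.linkingNumber_comp_left {γ c : ℝ → Space} (h : DisjointCurves γ c)
    (hp : Function.Periodic γ 1) :
    linkingNumber (fun s => γ (2 * s)) c = 2 * linkingNumber γ c := by
  have hI : Continuous fun s => ∫ t in (0 : ℝ)..1, gaussLinkingIntegrand γ c s t :=
    intervalIntegral.continuous_parametric_intervalIntegral_of_continuous'
      (f := fun s t => gaussLinkingIntegrand γ c s t) h.continuous_integrand 0 1
  have hper : Function.Periodic (fun s => ∫ t in (0 : ℝ)..1, gaussLinkingIntegrand γ c s t) 1 :=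
    fun s => by simp only [gaussLinkingIntegrand_eq, hp s, hp.deriv s]
  have h2 := hper.integral_comp_two_mul hI
  simp only [linkingNumber, gaussLinkingIntegrand_comp_left] at h2 ⊢
  simp only [intervalIntegral.integral_const_mul (2 : ℝ)
    (fun t => gaussLinkingIntegrand γ c _ t)]
  rw [h2]
  ring

/-- Traversing the second curve twice doubles the linking number. -/
lemma DisjointCurves.linkingNumber_comp_right {γ c : ℝ → Space} (h : DisjointCurves γ c)
    (hp : Function.Periodic c 1) :
    linkingNumber γ (fun t => c (2 * t)) = 2 * linkingNumber γ c := by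
  have hI : ∀ s, ∫ t in (0 : ℝ)..1, 2 * gaussLinkingIntegrand γ c s (2 * t) =
      2 * ∫ t in (0 : ℝ)..1, gaussLinkingIntegrand γ c s t := fun s => by
    have hF : Continuous fun t => gaussLinkingIntegrand γ c s t :=
      Continuous.comp (g := fun x : ℝ × ℝ => gaussLinkingIntegrand γ c x.1 x.2)
        (f := fun t => (s, t)) h.continuous_integrand (Continuous.prodMk_right s)
    have hper : Function.Periodic (fun t => gaussLinkingIntegrand γ c s t) 1 := fun t => by
      simp only [gaussLinkingIntegrand_eq, hp t, hp.deriv t]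
    exact hper.integral_comp_two_mul hF
  simp only [linkingNumber, gaussLinkingIntegrand_comp_right, hI]
  rw [intervalIntegral.integral_const_mul]
  ring

lemma linkingNumber_const_left (p : Space) (c : ℝ → Space) :
    linkingNumber (fun _ => p) c = 0 := by
  simp [linkingNumber, gaussLinkingIntegrand_eq, tripleProduct]

/-! ### Tubular coordinates around a closed curve -/

/-- Tubular coordinates `(s, x, y)` around the closed curve `s ↦ Ψ (s, 0, 0)`, in which
one turn around the curve reverses the normal coordinates. -/
structure IsTube (Ψ : ℝ × ℝ × ℝ → Space) : Prop where
  contDiff : ContDiff ℝ 1 Ψ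
  glue : ∀ s x y, Ψ (s + 1, x, y) = Ψ (s, -x, -y)
  core_inj : ∀ s t, Ψ (s, 0, 0) = Ψ (t, 0, 0) → ∃ k : ℤ, s = t + k
  immersive : ∀ s, Function.Injective (fderiv ℝ Ψ (s, 0, 0))

/-- A `C¹` map is expanding near a point where its derivative is injective. -/
lemma ContDiff.exists_expanding {E F : Type*} [NormedAddCommGroup E] [NormedSpace ℝ E]
    [FiniteDimensional ℝ E] [NormedAddCommGroup F] [NormedSpace ℝ F] {f : E → F}
    (hf : ContDiff ℝ 1 f) {p : E} (hinj : Function.Injective (fderiv ℝ f p)) :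
    ∃ k > 0, ∀ᶠ z : E × E in 𝓝 (p, p), k * ‖z.1 - z.2‖ ≤ ‖f z.1 - f z.2‖ := by
  obtain ⟨K, hK, hL⟩ := (fderiv ℝ f p : E →ₗ[ℝ] F).exists_antilipschitzWith
    (LinearMap.ker_eq_bot.2 hinj)
  have hK' : (0 : ℝ) < K := hK
  have hstrict := hf.contDiffAt.hasStrictFDerivAt (x := p) one_ne_zero
  refine ⟨(2 * K : ℝ)⁻¹, by positivity, ?_⟩
  filter_upwards [hstrict.isLittleO.def (c := (2 * K : ℝ)⁻¹) (by positivity)] with z hz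
  have h1 : ‖z.1 - z.2‖ ≤ K * ‖fderiv ℝ f p (z.1 - z.2)‖ := by
    have := hL.le_mul_norm_sub (z.1 - z.2) 0
    rwa [ContinuousLinearMap.coe_coe, map_zero, add_zero, add_zero, norm_neg, norm_neg] at this
  have h2 := norm_sub_norm_le (fderiv ℝ f p (z.1 - z.2)) (f z.1 - f z.2)
  rw [norm_sub_rev _ (f z.1 - f z.2)] at h2
  have h3 : (K : ℝ)⁻¹ * ‖z.1 - z.2‖ ≤ ‖fderiv ℝ f p (z.1 - z.2)‖ := by
    rw [inv_mul_le_iff₀ hK']; exact h1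
  have h4 : (2 * K : ℝ)⁻¹ = (K : ℝ)⁻¹ / 2 := by rw [mul_inv]; ring
  rw [h4] at hz ⊢
  linarith

namespace IsTube

variable {Ψ : ℝ × ℝ × ℝ → Space}

lemma core_periodic (h : IsTube Ψ) (k : ℤ) (t : ℝ) : Ψ (t + k, 0, 0) = Ψ (t, 0, 0) := by
  have hp : Function.Periodic (fun t => Ψ (t, 0, 0)) 1 := fun t => by simp [h.glue]
  simpa using hp.int_mul k t

lemma exists_sign (h : IsTube Ψ) (k : ℤ) : ∃ σ : ℝ, |σ| = 1 ∧
    ∀ s x y, Ψ (s + k, x, y) = Ψ (s, σ * x, σ * y) := by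
  induction k using Int.induction_on with
  | zero => exact ⟨1, by simp, by simp⟩
  | succ k ih =>
    obtain ⟨σ, hσ, h1⟩ := ih
    refine ⟨-σ, by simpa using hσ, fun s x y => ?_⟩
    have := h.glue (s + k) x y
    push_cast at h1 ⊢
    rw [← add_assoc, this, h1]
    simp
  | pred k ih =>
    obtain ⟨σ, hσ, h1⟩ := ih
    refine ⟨-σ, by simpa using hσ, fun s x y => ?_⟩
    have := h.glue (s + (-(k : ℤ) - 1 : ℤ)) (-x) (-y)
    push_cast at h1 this ⊢
    rw [neg_neg, neg_neg, show s + (-(k : ℝ) - 1) + 1 = s + -k by ring, h1] at this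
    rw [← this]
    simp

lemma eq_of_core_eq (h : IsTube Ψ) {s t : ℝ} (hst : |s - t| ≤ 1 / 2)
    (he : Ψ (s, 0, 0) = Ψ (t, 0, 0)) : s = t := by
  obtain ⟨k, hk⟩ := h.core_inj s t he
  have h1 : |(k : ℝ)| ≤ 1 / 2 := by rwa [hk, add_sub_cancel_left] at hst
  have h2 : |k| < 1 := by
    have : |(k : ℝ)| < 1 := h1.trans_lt (by norm_num)
    exact_mod_cast this
  simp [hk, Int.abs_lt_one_iff.1 h2]

lemma exists_lower_bound_aux (h : IsTube Ψ) : ∃ δ > 0, ∀ s ∈ Set.Icc (0 : ℝ) 1, ∀ t x y : ℝ,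
    |s - t| ≤ 1 / 2 → |x| ≤ δ → |y| ≤ δ →
      δ * ‖(s - t, x, y)‖ ≤ ‖Ψ (s, x, y) - Ψ (t, 0, 0)‖ := by
  have hK : IsCompact (Set.Icc (0 : ℝ) 1 ×ˢ Set.Icc (-1 : ℝ) 2) := isCompact_Icc.prod isCompact_Icc
  have hc := h.contDiff.continuous
  have key : ∀ᶠ z : ℝ × ℝ × ℝ in 𝓝 (0, 0, 0), ∀ q ∈ Set.Icc (0 : ℝ) 1 ×ˢ Set.Icc (-1 : ℝ) 2,
      |q.1 - q.2| ≤ 1 / 2 → z.1 * ‖(q.1 - q.2, z.2.1, z.2.2)‖ ≤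
        ‖Ψ (q.1, z.2.1, z.2.2) - Ψ (q.2, 0, 0)‖ := by
    refine hK.eventually_forall_of_forall_eventually fun q _ => ?_
    by_cases hq : Ψ (q.1, 0, 0) = Ψ (q.2, 0, 0)
    · by_cases hst : q.1 = q.2
      · obtain ⟨s, t⟩ := q
        obtain rfl : s = t := hst
        obtain ⟨k, hk, hev⟩ := h.contDiff.exists_expanding (h.immersive s)
        have ht : Tendsto (fun z : (ℝ × ℝ × ℝ) × ℝ × ℝ =>
            ((z.2.1, z.1.2.1, z.1.2.2), (z.2.2, (0 : ℝ), (0 : ℝ))))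
            (𝓝 ((0, 0, 0), s, s)) (𝓝 ((s, 0, 0), (s, 0, 0))) :=
          Continuous.tendsto' (by fun_prop) _ _ rfl
        have hk' : ∀ᶠ z : (ℝ × ℝ × ℝ) × ℝ × ℝ in 𝓝 ((0, 0, 0), s, s), z.1.1 < k :=
          ContinuousAt.eventually_lt (by fun_prop) (by fun_prop) hk
        filter_upwards [ht.eventually hev, hk'] with z h1 h2 _
        rw [Prod.mk_sub_mk, Prod.mk_sub_mk, sub_zero, sub_zero] at h1
        exact le_trans (by gcongr) h1
      · have : 1 / 2 < |q.1 - q.2| := by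
          by_contra! hle
          exact hst (h.eq_of_core_eq hle hq)
        have hev : ∀ᶠ z : (ℝ × ℝ × ℝ) × ℝ × ℝ in 𝓝 ((0, 0, 0), q), 1 / 2 < |z.2.1 - z.2.2| :=
          ContinuousAt.eventually_lt (by fun_prop) (by fun_prop) this
        filter_upwards [hev] with z h1 h2
        exact absurd h2 (not_le.2 h1)
    · have hev : ∀ᶠ z : (ℝ × ℝ × ℝ) × ℝ × ℝ in 𝓝 ((0, 0, 0), q),
          z.1.1 * ‖(z.2.1 - z.2.2, z.1.2.1, z.1.2.2)‖ <
            ‖Ψ (z.2.1, z.1.2.1, z.1.2.2) - Ψ (z.2.2, 0, 0)‖ := by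
        refine ContinuousAt.eventually_lt (by fun_prop) (by fun_prop) ?_
        simpa [sub_eq_zero] using hq
      filter_upwards [hev] with z h1 _ using h1.le
  obtain ⟨r, hr, hball⟩ := Metric.eventually_nhds_iff_ball.1 key
  refine ⟨r / 2, by positivity, fun s hs t x y hst hx hy => ?_⟩
  refine hball (r / 2, x, y) ?_ (s, t) ⟨hs, ?_⟩ hst
  · have hx' : |x| < r := by linarith
    have hy' : |y| < r := by linarith
    simp [Prod.dist_eq, hx', hy', abs_of_pos hr, hr]
  · obtain ⟨h1, h2⟩ := abs_le.1 hst
    obtain ⟨h3, h4⟩ := hs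
    exact ⟨by simp only; linarith, by simp only; linarith⟩

/-- The tube of radius `δ` stays quantitatively away from its core. -/
def IsRadius (Ψ : ℝ × ℝ × ℝ → Space) (δ : ℝ) : Prop :=
  ∀ s t x y : ℝ, |s - t| ≤ 1 / 2 → |x| ≤ δ → |y| ≤ δ →
    δ * ‖(s - t, x, y)‖ ≤ ‖Ψ (s, x, y) - Ψ (t, 0, 0)‖

lemma exists_isRadius (h : IsTube Ψ) : ∃ δ > 0, IsRadius Ψ δ := by
  obtain ⟨δ, hδ, hb⟩ := h.exists_lower_bound_aux
  refine ⟨δ, hδ, fun s t x y hst hx hy => ?_⟩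
  obtain ⟨σ, hσ, hs⟩ := h.exists_sign ⌊s⌋
  have h1 := hb (Int.fract s) ⟨Int.fract_nonneg s, (Int.fract_lt_one s).le⟩ (t - ⌊s⌋) (σ * x)
    (σ * y) (by rwa [Int.fract, sub_sub_sub_cancel_right]) (by rwa [abs_mul, hσ, one_mul])
    (by rwa [abs_mul, hσ, one_mul])
  rw [← hs, ← h.core_periodic ⌊s⌋ (t - ⌊s⌋), Int.fract_add_floor, sub_add_cancel, Int.fract,
    sub_sub_sub_cancel_right] at h1
  simpa [Prod.norm_def, abs_mul, hσ] using h1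

lemma ne_core (h : IsTube Ψ) {δ : ℝ} (hδ : 0 < δ) (hr : IsRadius Ψ δ) {x y : ℝ} (hx : |x| ≤ δ)
    (hy : |y| ≤ δ) (hxy : (x, y) ≠ 0) (s t : ℝ) : Ψ (s, x, y) ≠ Ψ (t, 0, 0) := by
  intro he
  have h1 : |s - (t + round (s - t))| ≤ 1 / 2 := by
    rw [← sub_sub]; exact abs_sub_round (s - t)
  have h2 := hr s (t + round (s - t)) x y h1 hx hy
  rw [h.core_periodic, he, sub_self, norm_zero] at h2
  have h3 : 0 < ‖(s - (t + round (s - t)), x, y)‖ := by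
    refine norm_pos_iff.2 fun h0 => hxy ?_
    exact congrArg Prod.snd h0
  exact absurd h2 (not_le.2 (mul_pos hδ h3))

end IsTube

/-! ### The linking number of a meridian -/

open MeasureTheory in
lemma Function.Periodic.integral_eq_integral_rescaled {F : ℝ → ℝ} (hp : Function.Periodic F 1)
    {δ : ℝ} (hδ : 0 < δ) :
    ∫ t in (0 : ℝ)..1, F t =
      ∫ τ, (Set.Ioc (-(2 * δ)⁻¹) (2 * δ)⁻¹).indicator (fun τ => δ * F (δ * τ)) τ := by
  have h1 := hp.intervalIntegral_add_eq 0 (-(1 / 2))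
  have h2 := intervalIntegral.smul_integral_comp_mul_left (a := -(2 * δ)⁻¹) (b := (2 * δ)⁻¹) F δ
  have h3 : δ * (2 * δ)⁻¹ = 1 / 2 := by field_simp
  rw [mul_neg, h3, smul_eq_mul] at h2
  rw [integral_indicator measurableSet_Ioc,
    ← intervalIntegral.integral_of_le (by linarith [inv_pos.2 (by positivity : 0 < 2 * δ)]),
    intervalIntegral.integral_const_mul, h2]
  norm_num at h1 ⊢
  exact h1

open MeasureTheory in
lemma integral_kernel {α ρ : ℝ} (hα : 0 < α) (hρ : 0 < ρ) (τ₀ : ℝ) :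
    ∫ τ, α * ρ ^ 2 / √(α ^ 2 * (τ - τ₀) ^ 2 + ρ ^ 2) ^ 3 = 2 := by
  rw [integral_sub_right_eq_self (fun τ => α * ρ ^ 2 / √(α ^ 2 * τ ^ 2 + ρ ^ 2) ^ 3) τ₀]
  have hpos : ∀ τ : ℝ, 0 < α ^ 2 * τ ^ 2 + ρ ^ 2 := fun τ => by positivity
  have hsq : ∀ τ : ℝ, 0 < √(α ^ 2 * τ ^ 2 + ρ ^ 2) := fun τ => Real.sqrt_pos.2 (hpos τ)
  have hder : ∀ τ, HasDerivAt (fun τ => α * τ / √(α ^ 2 * τ ^ 2 + ρ ^ 2))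
      (α * ρ ^ 2 / √(α ^ 2 * τ ^ 2 + ρ ^ 2) ^ 3) τ := fun τ => by
    have h1 : HasDerivAt (fun τ : ℝ => α ^ 2 * τ ^ 2 + ρ ^ 2) (α ^ 2 * (2 * τ)) τ := by
      simpa using ((hasDerivAt_pow 2 τ).const_mul (α ^ 2)).add_const (ρ ^ 2)
    have h2 := ((hasDerivAt_id τ).const_mul α).div (h1.sqrt (hpos τ).ne') (hsq τ).ne'
    refine HasDerivAt.congr_deriv (f := fun τ => α * τ / √(α ^ 2 * τ ^ 2 + ρ ^ 2)) h2 ?_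
    have h3 := Real.sq_sqrt (hpos τ).le
    have h4 := (hsq τ).ne'
    simp only [id]
    field_simp
    rw [h3]
    ring
  have hlim : Tendsto (fun τ => α * τ / √(α ^ 2 * τ ^ 2 + ρ ^ 2)) atTop (𝓝 1) := by
    have h1 : Tendsto (fun τ : ℝ => α / √(α ^ 2 + ρ ^ 2 * (τ⁻¹) ^ 2)) atTop
        (𝓝 (α / √(α ^ 2 + ρ ^ 2 * 0 ^ 2))) := by
      have h0 := tendsto_inv_atTop_zero (𝕜 := ℝ)
      refine Tendsto.div tendsto_const_nhds
        (Tendsto.sqrt (tendsto_const_nhds.add (tendsto_const_nhds.mul (h0.pow 2)))) ?_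
      simp [Real.sqrt_sq hα.le, hα.ne']
    have h2 : α / √(α ^ 2 + ρ ^ 2 * 0 ^ 2) = 1 := by simp [Real.sqrt_sq hα.le, hα.ne']
    rw [h2] at h1
    refine h1.congr' ?_
    filter_upwards [eventually_gt_atTop 0] with τ hτ
    have h3 : α ^ 2 * τ ^ 2 + ρ ^ 2 = τ ^ 2 * (α ^ 2 + ρ ^ 2 * (τ⁻¹) ^ 2) := by
      field_simp
    rw [h3, Real.sqrt_mul (sq_nonneg τ), Real.sqrt_sq hτ.le, mul_comm α τ,
      mul_div_mul_left _ _ hτ.ne']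
  have hlim' : Tendsto (fun τ => α * τ / √(α ^ 2 * τ ^ 2 + ρ ^ 2)) atBot (𝓝 (-1)) := by
    refine (hlim.neg.comp tendsto_neg_atBot_atTop).congr fun τ => ?_
    simp [neg_div]
  have hInt : Integrable fun τ => α * ρ ^ 2 / √(α ^ 2 * τ ^ 2 + ρ ^ 2) ^ 3 := by
    have hm : 0 < min (α ^ 2) (ρ ^ 2) := lt_min (by positivity) (by positivity)
    refine (integrable_inv_one_add_sq.const_mul (α * ρ / min (α ^ 2) (ρ ^ 2))).mono' ?_ ?_
    · exact (Continuous.div (by fun_prop) (by fun_prop)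
        fun τ => pow_ne_zero 3 (hsq τ).ne').aestronglyMeasurable
    · refine ae_of_all _ fun τ => ?_
      have h1 : ρ ≤ √(α ^ 2 * τ ^ 2 + ρ ^ 2) := Real.le_sqrt_of_sq_le (by nlinarith [sq_nonneg (α * τ)])
      have h2 : min (α ^ 2) (ρ ^ 2) * (1 + τ ^ 2) ≤ √(α ^ 2 * τ ^ 2 + ρ ^ 2) ^ 2 := by
        rw [Real.sq_sqrt (hpos τ).le]
        nlinarith [min_le_left (α ^ 2) (ρ ^ 2), min_le_right (α ^ 2) (ρ ^ 2), sq_nonneg τ]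
      have h3 := hsq τ
      rw [Real.norm_of_nonneg (by positivity), ← div_eq_mul_inv, div_div,
        div_le_div_iff₀ (by positivity) (by positivity)]
      calc α * ρ ^ 2 * (min (α ^ 2) (ρ ^ 2) * (1 + τ ^ 2))
          = α * ρ * (ρ * (min (α ^ 2) (ρ ^ 2) * (1 + τ ^ 2))) := by ring
        _ ≤ α * ρ * (√(α ^ 2 * τ ^ 2 + ρ ^ 2) * √(α ^ 2 * τ ^ 2 + ρ ^ 2) ^ 2) := by gcongr
        _ = _ := by ring
  rw [integral_of_hasDerivAt_of_tendsto hder hInt hlim' hlim]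
  norm_num

lemma abs_coord_le (x : Space) (i : Fin 3) : |x i| ≤ ‖x‖ := PiLp.norm_apply_le x i

lemma abs_tripleProduct_le (a b x : Space) : |tripleProduct a b x| ≤ 6 * (‖a‖ * ‖b‖ * ‖x‖) := by
  have key : ∀ i j k : Fin 3, |a i * (b j * x k)| ≤ ‖a‖ * ‖b‖ * ‖x‖ := fun i j k => by
    rw [abs_mul, abs_mul, mul_assoc]
    gcongr <;> exact abs_coord_le _ _
  have h := fun i j k => abs_le.1 (key i j k)
  rw [tripleProduct, abs_le]
  constructor <;> linarith [h 0 1 2, h 0 2 1, h 1 0 2, h 1 2 0, h 2 0 1, h 2 1 0]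

namespace IsTube

variable {Ψ : ℝ × ℝ × ℝ → Space}

/-- The meridian of radius `δ` at parameter `0`. -/
noncomputable def meridian (Ψ : ℝ × ℝ × ℝ → Space) (δ s : ℝ) : Space :=
  Ψ (0, δ * Real.cos (2 * Real.pi * s), δ * Real.sin (2 * Real.pi * s))

lemma abs_mul_cos_le {δ : ℝ} (hδ : 0 ≤ δ) (θ : ℝ) : |δ * Real.cos θ| ≤ δ := by
  rw [abs_mul, abs_of_nonneg hδ]
  exact mul_le_of_le_one_right hδ (Real.abs_cos_le_one θ)

lemma abs_mul_sin_le {δ : ℝ} (hδ : 0 ≤ δ) (θ : ℝ) : |δ * Real.sin θ| ≤ δ := by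
  rw [abs_mul, abs_of_nonneg hδ]
  exact mul_le_of_le_one_right hδ (Real.abs_sin_le_one θ)

lemma polar_ne_zero {δ : ℝ} (hδ : 0 < δ) (θ : ℝ) :
    (δ * Real.cos θ, δ * Real.sin θ) ≠ 0 := by
  intro h
  simp only [Prod.mk_eq_zero, mul_eq_zero, hδ.ne', false_or] at h
  have := Real.cos_sq_add_sin_sq θ
  simp [h.1, h.2] at this

lemma disjointCurves_meridian (h : IsTube Ψ) {r δ : ℝ} (hr : IsRadius Ψ r) (hδ : 0 < δ)
    (hδr : δ ≤ r) : DisjointCurves (meridian Ψ δ) (fun t => Ψ (t, 0, 0)) where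
  left := h.contDiff.comp (by fun_prop)
  right := h.contDiff.comp (by fun_prop)
  ne s t := h.ne_core (hδ.trans_le hδr) hr ((abs_mul_cos_le hδ.le _).trans hδr)
    ((abs_mul_sin_le hδ.le _).trans hδr) (polar_ne_zero hδ _) 0 t

/-- The derivative of the meridian, divided by its radius. -/
noncomputable def meridianTangent (Ψ : ℝ × ℝ × ℝ → Space) (δ s : ℝ) : Space :=
  fderiv ℝ Ψ (0, δ * Real.cos (2 * Real.pi * s), δ * Real.sin (2 * Real.pi * s))
    (0, -(2 * Real.pi * Real.sin (2 * Real.pi * s)), 2 * Real.pi * Real.cos (2 * Real.pi * s))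

lemma deriv_meridian (h : IsTube Ψ) (δ s : ℝ) :
    deriv (meridian Ψ δ) s = δ • meridianTangent Ψ δ s := by
  have h0 : HasDerivAt (fun s : ℝ => 2 * Real.pi * s) (2 * Real.pi) s := by
    simpa using (hasDerivAt_id s).const_mul (2 * Real.pi)
  have h1 := (hasDerivAt_const s (0 : ℝ)).prodMk
    ((h0.cos.const_mul δ).prodMk (h0.sin.const_mul δ))
  have h2 := ((h.contDiff.differentiable one_ne_zero
    (0, δ * Real.cos (2 * Real.pi * s), δ * Real.sin (2 * Real.pi * s))).hasFDerivAt
    ).comp_hasDerivAt s h1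
  refine h2.deriv.trans ?_
  rw [meridianTangent, ← map_smul]
  congr 1
  simp only [Prod.smul_mk, smul_eq_mul, mul_zero, Prod.mk.injEq, true_and]
  constructor <;> ring

lemma deriv_core (h : IsTube Ψ) (t : ℝ) :
    deriv (fun t => Ψ (t, 0, 0)) t = fderiv ℝ Ψ (t, 0, 0) (1, 0, 0) := by
  have h1 : HasDerivAt (fun t : ℝ => (t, (0 : ℝ), (0 : ℝ))) (1, 0, 0) t :=
    (hasDerivAt_id t).prodMk ((hasDerivAt_const t 0).prodMk (hasDerivAt_const t 0))
  exact (((h.contDiff.differentiable one_ne_zero (t, 0, 0)).hasFDerivAt).comp_hasDerivAt t h1).deriv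

lemma tripleProduct_rescale {δ : ℝ} (hδ : 0 < δ) (a b x : Space) :
    δ * (tripleProduct (δ • a) b x / ‖x‖ ^ 3) =
      tripleProduct a b (δ⁻¹ • x) / ‖δ⁻¹ • x‖ ^ 3 := by
  rw [norm_smul, Real.norm_of_nonneg (by positivity)]
  simp only [tripleProduct, PiLp.smul_apply, smul_eq_mul]
  field_simp

/-- The chord from the core to the meridian, rescaled. -/
noncomputable def meridianChord (Ψ : ℝ × ℝ × ℝ → Space) (δ s τ : ℝ) : Space :=
  δ⁻¹ • (meridian Ψ δ s - Ψ (δ * τ, 0, 0))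

lemma rescaled_integrand (h : IsTube Ψ) {δ : ℝ} (hδ : 0 < δ) (s τ : ℝ) :
    δ * gaussLinkingIntegrand (meridian Ψ δ) (fun t => Ψ (t, 0, 0)) s (δ * τ) =
      tripleProduct (meridianTangent Ψ δ s) (fderiv ℝ Ψ (δ * τ, 0, 0) (1, 0, 0))
        (meridianChord Ψ δ s τ) / ‖meridianChord Ψ δ s τ‖ ^ 3 := by
  rw [gaussLinkingIntegrand_eq, h.deriv_meridian, h.deriv_core, tripleProduct_rescale hδ]
  rfl

lemma chord_lower_bound {r δ : ℝ} (hr0 : 0 < r) (hr : IsRadius Ψ r) (hδ : 0 < δ)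
    (hδr : δ ≤ r) {τ : ℝ} (hτ : |τ| ≤ (2 * δ)⁻¹) (s : ℝ) :
    r ^ 2 * (1 + τ ^ 2) / 3 ≤ ‖meridianChord Ψ δ s τ‖ ^ 2 := by
  set θ := 2 * Real.pi * s with hθ
  have h1 : |0 - δ * τ| ≤ 1 / 2 := by
    rw [zero_sub, abs_neg, abs_mul, abs_of_pos hδ]
    calc δ * |τ| ≤ δ * (2 * δ)⁻¹ := by gcongr
      _ = 1 / 2 := by field_simp
  have h2 := hr 0 (δ * τ) (δ * Real.cos θ) (δ * Real.sin θ) h1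
    ((abs_mul_cos_le hδ.le _).trans hδr) ((abs_mul_sin_le hδ.le _).trans hδr)
  set N := ‖(0 - δ * τ, δ * Real.cos θ, δ * Real.sin θ)‖ with hN
  have hN0 : 0 ≤ N := norm_nonneg _
  have e1 : |δ * τ| ≤ N := by
    rw [← abs_neg, ← zero_sub]
    exact norm_fst_le (0 - δ * τ, δ * Real.cos θ, δ * Real.sin θ)
  have e2 : |δ * Real.cos θ| ≤ N := (norm_fst_le (δ * Real.cos θ, δ * Real.sin θ)).trans
    (norm_snd_le (0 - δ * τ, δ * Real.cos θ, δ * Real.sin θ))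
  have e3 : |δ * Real.sin θ| ≤ N := (norm_snd_le (δ * Real.cos θ, δ * Real.sin θ)).trans
    (norm_snd_le (0 - δ * τ, δ * Real.cos θ, δ * Real.sin θ))
  have f1 := sq_le_sq' (neg_le_of_abs_le e1) (le_of_abs_le e1)
  have f2 := sq_le_sq' (neg_le_of_abs_le e2) (le_of_abs_le e2)
  have f3 := sq_le_sq' (neg_le_of_abs_le e3) (le_of_abs_le e3)
  have f4 : δ ^ 2 * (1 + τ ^ 2) / 3 ≤ N ^ 2 := by
    have := Real.cos_sq_add_sin_sq θ
    have : δ ^ 2 * (1 + τ ^ 2) =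
        (δ * τ) ^ 2 + (δ * Real.cos θ) ^ 2 + (δ * Real.sin θ) ^ 2 := by
      linear_combination -δ ^ 2 * this
    linarith
  have h3 : (r * N) ^ 2 ≤ ‖meridian Ψ δ s - Ψ (δ * τ, 0, 0)‖ ^ 2 :=
    pow_le_pow_left₀ (by positivity) h2 2
  rw [meridianChord, norm_smul, Real.norm_of_nonneg (by positivity), mul_pow]
  calc r ^ 2 * (1 + τ ^ 2) / 3 = δ⁻¹ ^ 2 * (r ^ 2 * (δ ^ 2 * (1 + τ ^ 2) / 3)) := by field_simp
    _ ≤ δ⁻¹ ^ 2 * (r ^ 2 * N ^ 2) := by gcongr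
    _ ≤ _ := by rw [← mul_pow]; gcongr

lemma abs_div_norm_cube_le (a b x : Space) {A B C : ℝ} (hA : ‖a‖ ≤ A) (hB : ‖b‖ ≤ B)
    (hC : 0 < C) (hx : C ≤ ‖x‖ ^ 2) : |tripleProduct a b x / ‖x‖ ^ 3| ≤ 6 * (A * B) / C := by
  have hx0 : 0 < ‖x‖ := by
    by_contra! h0
    have : ‖x‖ = 0 := le_antisymm h0 (norm_nonneg x)
    rw [this] at hx
    norm_num at hx
    linarith
  have hA0 := (norm_nonneg a).trans hA
  have hB0 := (norm_nonneg b).trans hB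
  rw [abs_div, abs_of_pos (pow_pos hx0 3), div_le_div_iff₀ (by positivity) hC]
  calc |tripleProduct a b x| * C ≤ 6 * (‖a‖ * ‖b‖ * ‖x‖) * ‖x‖ ^ 2 := by
        gcongr; exact abs_tripleProduct_le a b x
    _ ≤ 6 * (A * B * ‖x‖) * ‖x‖ ^ 2 := by gcongr
    _ = _ := by ring

lemma exists_tangent_bound (h : IsTube Ψ) (r : ℝ) : ∃ A, 0 ≤ A ∧ ∀ t x y, |t| ≤ 1 / 2 → |x| ≤ r →
    |y| ≤ r → ‖fderiv ℝ Ψ (t, x, y)‖ ≤ A := by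
  have hK : IsCompact (Set.Icc (-(1 / 2) : ℝ) (1 / 2) ×ˢ Set.Icc (-r) r ×ˢ Set.Icc (-r) r) :=
    isCompact_Icc.prod (isCompact_Icc.prod isCompact_Icc)
  obtain ⟨A, hA⟩ := hK.exists_bound_of_continuousOn
    (h.contDiff.continuous_fderiv one_ne_zero).continuousOn
  exact ⟨max A 0, le_max_right _ _, fun t x y ht hx hy =>
    (hA (t, x, y) ⟨abs_le.1 ht, abs_le.1 hx, abs_le.1 hy⟩).trans (le_max_left _ _)⟩

/-- Integrable domination of the rescaled Gauss integrand, uniform in the radius. -/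
lemma exists_rescaled_bound (h : IsTube Ψ) {r : ℝ} (hr0 : 0 < r) (hr : IsRadius Ψ r) :
    ∃ C, 0 ≤ C ∧ ∀ δ, 0 < δ → δ ≤ r → ∀ s τ, |τ| ≤ (2 * δ)⁻¹ →
      |δ * gaussLinkingIntegrand (meridian Ψ δ) (fun t => Ψ (t, 0, 0)) s (δ * τ)| ≤
        C * (1 + τ ^ 2)⁻¹ := by
  obtain ⟨A, hA0, hA⟩ := h.exists_tangent_bound r
  have hpi := Real.pi_pos
  refine ⟨6 * ((A * (2 * Real.pi)) * A) / (r ^ 2 / 3), by positivity, fun δ hδ hδr s τ hτ => ?_⟩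
  rw [h.rescaled_integrand hδ]
  have h1 : ‖meridianTangent Ψ δ s‖ ≤ A * (2 * Real.pi) := by
    refine (ContinuousLinearMap.le_opNorm _ _).trans ?_
    gcongr
    · exact hA _ _ _ (by norm_num) ((abs_mul_cos_le hδ.le _).trans hδr)
        ((abs_mul_sin_le hδ.le _).trans hδr)
    · simp only [Prod.norm_def, norm_zero, norm_neg, Real.norm_eq_abs]
      exact max_le (by positivity) (max_le (abs_mul_sin_le (by positivity) _)
        (abs_mul_cos_le (by positivity) _))
  have h2 : ‖fderiv ℝ Ψ (δ * τ, 0, 0) (1, 0, 0)‖ ≤ A := by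
    refine (ContinuousLinearMap.le_opNorm _ _).trans ?_
    have : ‖((1 : ℝ), (0 : ℝ), (0 : ℝ))‖ = 1 := by simp [Prod.norm_def]
    rw [this, mul_one]
    refine hA _ _ _ ?_ (by simpa using hr0.le) (by simpa using hr0.le)
    rw [abs_mul, abs_of_pos hδ]
    calc δ * |τ| ≤ δ * (2 * δ)⁻¹ := by gcongr
      _ = 1 / 2 := by field_simp
  refine (abs_div_norm_cube_le _ _ _ h1 h2 (by positivity)
    (chord_lower_bound hr0 hr hδ hδr hτ s)).trans (le_of_eq ?_)
  field_simp

end IsTube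

/-- The vector `w` is orthogonal to `a` and `v`, its norm is the distance from `v` to the line
`ℝ a`, and `(a, v, w)` is positively oriented. -/
structure NormalFrame (a v w : Space) : Prop where
  pos_left : 0 < ‖a‖
  pos_right : 0 < ‖w‖
  inner_left : inner ℝ a w = 0
  inner_right : inner ℝ v w = 0
  norm_sq : ‖a‖ ^ 2 * ‖w‖ ^ 2 = ‖a‖ ^ 2 * ‖v‖ ^ 2 - inner ℝ a v ^ 2
  tripleProduct_eq : tripleProduct w a v = ‖a‖ * ‖w‖ ^ 2

namespace NormalFrame

variable {a v w : Space}

lemma tripleProduct_circle (h : NormalFrame a v w) (θ τ : ℝ) :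
    tripleProduct (-(2 * Real.pi * Real.sin θ) • v + (2 * Real.pi * Real.cos θ) • w) a
      (-τ • a + (Real.cos θ • v + Real.sin θ • w)) = 2 * Real.pi * (‖a‖ * ‖w‖ ^ 2) := by
  have h1 : tripleProduct (-(2 * Real.pi * Real.sin θ) • v + (2 * Real.pi * Real.cos θ) • w) a
      (-τ • a + (Real.cos θ • v + Real.sin θ • w)) =
      2 * Real.pi * (Real.cos θ ^ 2 + Real.sin θ ^ 2) * tripleProduct w a v := by
    simp only [tripleProduct, PiLp.add_apply, PiLp.smul_apply, smul_eq_mul]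
    ring
  rw [h1, Real.cos_sq_add_sin_sq, h.tripleProduct_eq, mul_one]

lemma norm_circle_sq (h : NormalFrame a v w) (θ τ : ℝ) :
    ‖-τ • a + (Real.cos θ • v + Real.sin θ • w)‖ ^ 2 =
      ‖a‖ ^ 2 * (τ - Real.cos θ * inner ℝ a v / ‖a‖ ^ 2) ^ 2 + ‖w‖ ^ 2 := by
  have h0 := h.pos_left.ne'
  rw [norm_add_sq_real, norm_add_sq_real]
  simp only [inner_add_right, inner_smul_left, inner_smul_right, h.inner_left, h.inner_right,
    norm_smul, mul_pow, Real.norm_eq_abs, sq_abs, conj_trivial]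
  field_simp
  linear_combination Real.cos θ ^ 2 * h.norm_sq.symm +
    ‖a‖ ^ 2 * ‖w‖ ^ 2 * Real.cos_sq_add_sin_sq θ

lemma circle_ne_zero (h : NormalFrame a v w) (θ τ : ℝ) :
    -τ • a + (Real.cos θ • v + Real.sin θ • w) ≠ 0 := by
  intro h0
  have := h.norm_circle_sq θ τ
  have h1 := h.pos_right
  have h2 := h.pos_left
  rw [h0, norm_zero] at this
  have h3 : 0 < ‖a‖ ^ 2 * (τ - Real.cos θ * inner ℝ a v / ‖a‖ ^ 2) ^ 2 + ‖w‖ ^ 2 := by positivity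
  rw [← this] at h3
  norm_num at h3

/-- The Gauss integral of a straight line, with respect to a circle around it. -/
lemma integral_circle (h : NormalFrame a v w) (θ : ℝ) :
    ∫ τ : ℝ, tripleProduct (-(2 * Real.pi * Real.sin θ) • v + (2 * Real.pi * Real.cos θ) • w) a
      (-τ • a + (Real.cos θ • v + Real.sin θ • w)) /
        ‖-τ • a + (Real.cos θ • v + Real.sin θ • w)‖ ^ 3 = 4 * Real.pi := by
  have h1 : ∀ τ : ℝ, ‖-τ • a + (Real.cos θ • v + Real.sin θ • w)‖ =
      √(‖a‖ ^ 2 * (τ - Real.cos θ * inner ℝ a v / ‖a‖ ^ 2) ^ 2 + ‖w‖ ^ 2) := fun τ => by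
    rw [← h.norm_circle_sq, Real.sqrt_sq (norm_nonneg _)]
  simp only [h.tripleProduct_circle, h1, mul_div_assoc (2 * Real.pi)]
  rw [MeasureTheory.integral_const_mul, integral_kernel h.pos_left h.pos_right]
  ring

end NormalFrame

namespace IsTube

variable {Ψ : ℝ × ℝ × ℝ → Space} {a v w : Space}

lemma tendsto_chord (h : IsTube Ψ)
    (hL : ∀ x y z, fderiv ℝ Ψ (0, 0, 0) (x, y, z) = x • a + (y • v + z • w)) (s τ : ℝ) :
    Tendsto (fun δ => meridianChord Ψ δ s τ) (𝓝[>] 0)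
      (𝓝 (-τ • a + (Real.cos (2 * Real.pi * s) • v + Real.sin (2 * Real.pi * s) • w))) := by
  set C := Real.cos (2 * Real.pi * s) with hC
  set S := Real.sin (2 * Real.pi * s) with hS
  have hd := h.contDiff.differentiable one_ne_zero (0, 0, 0)
  have e1 : HasDerivAt (fun δ : ℝ => ((0 : ℝ), δ * C, δ * S)) (0, C, S) 0 := by
    simpa using (hasDerivAt_const (0 : ℝ) (0 : ℝ)).prodMk
      (((hasDerivAt_id (0 : ℝ)).mul_const C).prodMk ((hasDerivAt_id (0 : ℝ)).mul_const S))
  have e2 : HasDerivAt (fun δ : ℝ => (δ * τ, (0 : ℝ), (0 : ℝ))) (τ, 0, 0) 0 := by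
    simpa using ((hasDerivAt_id (0 : ℝ)).mul_const τ).prodMk
      ((hasDerivAt_const (0 : ℝ) (0 : ℝ)).prodMk (hasDerivAt_const (0 : ℝ) (0 : ℝ)))
  have f1 := HasFDerivAt.comp_hasDerivAt_of_eq (0 : ℝ) hd.hasFDerivAt e1 (by simp)
  have f2 := HasFDerivAt.comp_hasDerivAt_of_eq (0 : ℝ) hd.hasFDerivAt e2 (by simp)
  have f3 := (f1.sub f2).tendsto_slope_zero_right
  simp only [hL, Function.comp_def, Pi.sub_apply, zero_add, zero_mul, sub_self, sub_zero, zero_smul,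
    add_zero] at f3
  have e : -τ • a + (C • v + S • w) = C • v + S • w - τ • a := by
    rw [neg_smul]
    abel
  rw [e]
  exact f3

lemma tendsto_rescaled_integrand (h : IsTube Ψ) (hf : NormalFrame a v w)
    (hL : ∀ x y z, fderiv ℝ Ψ (0, 0, 0) (x, y, z) = x • a + (y • v + z • w)) (s τ : ℝ) :
    Tendsto (fun δ => δ * gaussLinkingIntegrand (meridian Ψ δ) (fun t => Ψ (t, 0, 0)) s (δ * τ))
      (𝓝[>] 0) (𝓝 (tripleProduct
        (-(2 * Real.pi * Real.sin (2 * Real.pi * s)) • v +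
          (2 * Real.pi * Real.cos (2 * Real.pi * s)) • w) a
        (-τ • a + (Real.cos (2 * Real.pi * s) • v + Real.sin (2 * Real.pi * s) • w)) /
        ‖-τ • a + (Real.cos (2 * Real.pi * s) • v + Real.sin (2 * Real.pi * s) • w)‖ ^ 3)) := by
  have hc := h.contDiff.continuous_fderiv one_ne_zero
  have h1 : Tendsto (fun δ => meridianTangent Ψ δ s) (𝓝[>] 0)
      (𝓝 (-(2 * Real.pi * Real.sin (2 * Real.pi * s)) • v +
          (2 * Real.pi * Real.cos (2 * Real.pi * s)) • w)) := by
    refine tendsto_nhdsWithin_of_tendsto_nhds ?_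
    refine Continuous.tendsto' ?_ _ _ ?_
    · unfold meridianTangent
      fun_prop
    · simp [meridianTangent, hL]
  have h2 : Tendsto (fun δ : ℝ => fderiv ℝ Ψ (δ * τ, 0, 0) (1, 0, 0)) (𝓝[>] 0) (𝓝 a) := by
    refine tendsto_nhdsWithin_of_tendsto_nhds ?_
    exact Continuous.tendsto' (by fun_prop) _ _ (by simp [hL])
  have h3 := h.tendsto_chord hL s τ
  have h4 := (tendsto_tripleProduct h1 h2 h3).div (h3.norm.pow 3)
    (pow_ne_zero 3 (norm_ne_zero_iff.2 (hf.circle_ne_zero _ τ)))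
  refine h4.congr' ?_
  filter_upwards [self_mem_nhdsWithin] with δ hδ
  exact (h.rescaled_integrand hδ s τ).symm

end IsTube

namespace IsTube

variable {Ψ : ℝ × ℝ × ℝ → Space} {a v w : Space}

lemma periodic_integrand (h : IsTube Ψ) (γ : ℝ → Space) (s : ℝ) :
    Function.Periodic (fun t => gaussLinkingIntegrand γ (fun t => Ψ (t, 0, 0)) s t) 1 := by
  have hp : Function.Periodic (fun t => Ψ (t, 0, 0)) 1 := fun t => by simp [h.glue]
  intro t
  simp only [gaussLinkingIntegrand_eq, hp.deriv t]
  rw [show Ψ (t + 1, 0, 0) = Ψ (t, 0, 0) from hp t]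

lemma eventually_abs_le (τ : ℝ) : ∀ᶠ δ : ℝ in 𝓝[>] 0, |τ| < (2 * δ)⁻¹ := by
  have h1 : Tendsto (fun δ : ℝ => (2 * δ)⁻¹) (𝓝[>] 0) atTop := by
    simp only [mul_inv]
    exact tendsto_inv_nhdsGT_zero.const_mul_atTop (by norm_num)
  exact h1.eventually_gt_atTop _

open MeasureTheory in
/-- The linking number of a small meridian with the core tends to one. -/
lemma tendsto_linkingNumber_meridian (h : IsTube Ψ) (hf : NormalFrame a v w)
    (hL : ∀ x y z, fderiv ℝ Ψ (0, 0, 0) (x, y, z) = x • a + (y • v + z • w)) :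
    Tendsto (fun δ => linkingNumber (meridian Ψ δ) (fun t => Ψ (t, 0, 0))) (𝓝[>] 0) (𝓝 1) := by
  obtain ⟨r, hr0, hr⟩ := h.exists_isRadius
  obtain ⟨C, hC0, hC⟩ := h.exists_rescaled_bound hr0 hr
  have hsmall : ∀ᶠ δ : ℝ in 𝓝[>] 0, 0 < δ ∧ δ ≤ r := by
    filter_upwards [Ioc_mem_nhdsGT hr0] with δ hδ using hδ
  set G : ℝ → ℝ → ℝ → ℝ := fun δ s t =>
    gaussLinkingIntegrand (meridian Ψ δ) (fun t => Ψ (t, 0, 0)) s t with hG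
  set H : ℝ → ℝ → ℝ → ℝ := fun δ s => (Set.Ioc (-(2 * δ)⁻¹) (2 * δ)⁻¹).indicator
    (fun τ => δ * G δ s (δ * τ)) with hH
  have hinner : ∀ δ, 0 < δ → ∀ s, ∫ t in (0 : ℝ)..1, G δ s t = ∫ τ, H δ s τ := fun δ hδ s =>
    (h.periodic_integrand (meridian Ψ δ) s).integral_eq_integral_rescaled hδ
  have hcont : ∀ δ, 0 < δ → δ ≤ r → Continuous fun p : ℝ × ℝ => G δ p.1 p.2 := fun δ hδ hδr =>
    (h.disjointCurves_meridian hr hδ hδr).continuous_integrand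
  have hHbound : ∀ δ, 0 < δ → δ ≤ r → ∀ s τ, ‖H δ s τ‖ ≤ C * (1 + τ ^ 2)⁻¹ := by
    intro δ hδ hδr s τ
    by_cases hτ : τ ∈ Set.Ioc (-(2 * δ)⁻¹) (2 * δ)⁻¹
    · simp only [hH, Set.indicator_of_mem hτ]
      exact hC δ hδ hδr s τ (abs_le.2 ⟨hτ.1.le, hτ.2⟩)
    · simp only [hH, Set.indicator_of_notMem hτ, norm_zero]
      positivity
  have hHmeas : ∀ δ, 0 < δ → δ ≤ r → ∀ s, AEStronglyMeasurable (H δ s) := by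
    intro δ hδ hδr s
    have h1 : Continuous fun τ => G δ s (δ * τ) :=
      Continuous.comp (g := fun p : ℝ × ℝ => G δ p.1 p.2) (f := fun τ => (s, δ * τ))
        (hcont δ hδ hδr) (by fun_prop)
    exact ((continuous_const.mul h1).aestronglyMeasurable).indicator measurableSet_Ioc
  have hbint : Integrable fun τ : ℝ => C * (1 + τ ^ 2)⁻¹ := integrable_inv_one_add_sq.const_mul C
  have hlim : ∀ s, Tendsto (fun δ => ∫ t in (0 : ℝ)..1, G δ s t) (𝓝[>] 0)
      (𝓝 (4 * Real.pi)) := by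
    intro s
    have h1 : Tendsto (fun δ => ∫ τ, H δ s τ) (𝓝[>] 0) (𝓝 (4 * Real.pi)) := by
      rw [← hf.integral_circle (2 * Real.pi * s)]
      refine tendsto_integral_filter_of_dominated_convergence (fun τ => C * (1 + τ ^ 2)⁻¹)
        ?_ ?_ hbint ?_
      · filter_upwards [hsmall] with δ hδ using hHmeas δ hδ.1 hδ.2 s
      · filter_upwards [hsmall] with δ hδ
        exact ae_of_all _ fun τ => hHbound δ hδ.1 hδ.2 s τ
      · refine ae_of_all _ fun τ => ?_
        refine (h.tendsto_rescaled_integrand hf hL s τ).congr' ?_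
        filter_upwards [eventually_abs_le τ] with δ hδ
        have hτ : τ ∈ Set.Ioc (-(2 * δ)⁻¹) (2 * δ)⁻¹ := ⟨(abs_lt.1 hδ).1, (abs_lt.1 hδ).2.le⟩
        simp only [hH, hG, Set.indicator_of_mem hτ]
    refine h1.congr' ?_
    filter_upwards [hsmall] with δ hδ using (hinner δ hδ.1 s).symm
  have houter : Tendsto (fun δ => ∫ s in (0 : ℝ)..1, ∫ t in (0 : ℝ)..1, G δ s t) (𝓝[>] 0)
      (𝓝 (∫ _s in (0 : ℝ)..1, 4 * Real.pi)) := by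
    refine intervalIntegral.tendsto_integral_filter_of_dominated_convergence
      (fun _ => ∫ τ : ℝ, C * (1 + τ ^ 2)⁻¹) ?_ ?_ intervalIntegrable_const
      (ae_of_all _ fun s _ => hlim s)
    · filter_upwards [hsmall] with δ hδ
      exact (intervalIntegral.continuous_parametric_intervalIntegral_of_continuous'
        (f := fun s t => G δ s t) (hcont δ hδ.1 hδ.2) 0 1).aestronglyMeasurable
    · filter_upwards [hsmall] with δ hδ
      refine ae_of_all _ fun s _ => ?_
      rw [hinner δ hδ.1 s]
      exact norm_integral_le_of_norm_le hbint (ae_of_all _ fun τ => hHbound δ hδ.1 hδ.2 s τ)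
  have h2 := houter.const_mul (4 * Real.pi)⁻¹
  rw [intervalIntegral.integral_const, sub_zero, one_smul,
    inv_mul_cancel₀ (by positivity)] at h2
  exact h2

/-- All sufficiently small meridians link the core exactly once. -/
lemma eventually_linkingNumber_meridian (h : IsTube Ψ) (hf : NormalFrame a v w)
    (hL : ∀ x y z, fderiv ℝ Ψ (0, 0, 0) (x, y, z) = x • a + (y • v + z • w)) :
    ∀ᶠ δ in 𝓝[>] 0, linkingNumber (meridian Ψ δ) (fun t => Ψ (t, 0, 0)) = 1 := by
  obtain ⟨r, hr0, hr⟩ := h.exists_isRadius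
  filter_upwards [Ioc_mem_nhdsGT hr0,
    (h.tendsto_linkingNumber_meridian hf hL).eventually_const_lt (by norm_num : (0 : ℝ) < 1),
    (h.tendsto_linkingNumber_meridian hf hL).eventually_lt_const (by norm_num : (1 : ℝ) < 2)]
    with δ hδ h1 h2
  obtain ⟨n, hn⟩ := linkingNumber_mem_int (h.disjointCurves_meridian hr hδ.1 hδ.2)
    (by simpa using h.core_periodic 1 0) (by simp [meridian])
  rw [hn] at h1 h2 ⊢
  norm_cast at h1 h2 ⊢
  omega

end IsTube

namespace IsTube

variable {Ψ : ℝ × ℝ × ℝ → Space}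

/-- The point of the torus of radius `δ` with longitude `s` and angle `θ`. -/
noncomputable def torus (Ψ : ℝ × ℝ × ℝ → Space) (δ s θ : ℝ) : Space :=
  Ψ (s, δ * Real.cos θ, δ * Real.sin θ)

lemma torus_add_one (h : IsTube Ψ) (δ s θ : ℝ) : torus Ψ δ (s + 1) θ = torus Ψ δ s (θ + Real.pi) := by
  simp [torus, h.glue]

lemma torus_two (h : IsTube Ψ) (δ θ : ℝ) : torus Ψ δ 2 θ = torus Ψ δ 0 θ := by
  have e : (2 : ℝ) = 0 + 1 + 1 := by norm_num
  rw [e, h.torus_add_one, h.torus_add_one]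
  simp [torus]

lemma torus_ne_core (h : IsTube Ψ) {r δ : ℝ} (hr : IsRadius Ψ r) (hδ : 0 < δ) (hδr : δ ≤ r)
    (s θ t : ℝ) : torus Ψ δ s θ ≠ Ψ (t, 0, 0) :=
  h.ne_core (hδ.trans_le hδr) hr ((abs_mul_cos_le hδ.le _).trans hδr)
    ((abs_mul_sin_le hδ.le _).trans hδr) (polar_ne_zero hδ _) s t

lemma contDiff_torus (h : IsTube Ψ) (δ : ℝ) {E : Type*} [NormedAddCommGroup E] [NormedSpace ℝ E]
    {f g : E → ℝ} (hf : ContDiff ℝ 1 f) (hg : ContDiff ℝ 1 g) :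
    ContDiff ℝ 1 fun x => torus Ψ δ (f x) (g x) :=
  h.contDiff.comp (by fun_prop)

/-- Pushing the doubly traversed core to the boundary of the tube gives odd linking number. -/
lemma odd_linkingNumber (h : IsTube Ψ) {r δ : ℝ} (hr : IsRadius Ψ r) (hδ : 0 < δ) (hδr : δ ≤ r)
    (hm : linkingNumber (meridian Ψ δ) (fun t => Ψ (t, 0, 0)) = 1) :
    ∃ n : ℤ, Odd n ∧ linkingNumber (fun s => Ψ (2 * s, δ, 0)) (fun t => Ψ (t, 0, 0)) = n := by
  set c : ℝ → Space := fun t => Ψ (t, 0, 0) with hc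
  have hcs : ContDiff ℝ 1 c := h.contDiff.comp (by fun_prop)
  have hc1 : c 1 = c 0 := by simpa using h.core_periodic 1 0
  set Γ₁ : ℝ × ℝ → Space := fun p => torus Ψ δ (2 * p.2) (-(2 * Real.pi * p.1 * p.2)) with hΓ₁
  set Γ₂ : ℝ × ℝ → Space := fun p => torus Ψ δ 2 (-(2 * Real.pi * p.1 * (1 - p.2))) with hΓ₂
  have hs₁ : ContDiff ℝ 1 Γ₁ := h.contDiff_torus δ (by fun_prop) (by fun_prop)
  have hs₂ : ContDiff ℝ 1 Γ₂ := h.contDiff_torus δ (by fun_prop) (by fun_prop)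
  have hC : ContDiff ℝ 1 fun p : ℝ × ℝ => c p.2 := hcs.comp contDiff_snd
  have hne := h.torus_ne_core hr hδ hδr
  have hf : ContinuousOn (fun l => linkingNumber (fun s => Γ₁ (l, s)) c +
      linkingNumber (fun s => Γ₂ (l, s)) c) (Set.uIcc 0 1) :=
    (continuousOn_linkingNumber hs₁ hC fun _ _ _ _ => hne _ _ _).add
      (continuousOn_linkingNumber hs₂ hC fun _ _ _ _ => hne _ _ _)
  have key := hf.eq_of_int_valued fun l _ => linkingNumber_add_mem_int
    (disjointCurves_slice hs₁ hC fun _ _ => hne _ _ _)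
    (disjointCurves_slice hs₂ hC fun _ _ => hne _ _ _) hc1
    (by simp [hΓ₁, hΓ₂]) (by simp [hΓ₁, hΓ₂, h.torus_two])
  have e₁ : (fun s => Γ₁ (0, s)) = fun s => Ψ (2 * s, δ, 0) := by
    funext s; simp [hΓ₁, torus]
  have e₂ : (fun s => Γ₂ (0, s)) = fun _ => torus Ψ δ 2 0 := by
    funext s; simp [hΓ₂]
  set H : ℝ → Space := fun x => torus Ψ δ x (-(Real.pi * x)) with hH
  have e₃ : (fun s => Γ₁ (1, s)) = fun s => H (2 * s) := by
    funext s
    simp only [hΓ₁, hH]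
    congr 1
    ring
  have e₄ : (fun s => Γ₂ (1, s)) = meridian Ψ δ := by
    funext s
    have : -(2 * Real.pi * 1 * (1 - s)) = 2 * Real.pi * s - 2 * Real.pi := by ring
    simp only [hΓ₂, h.torus_two, this]
    simp [torus, meridian]
  have hHp : Function.Periodic H 1 := fun x => by
    simp only [hH, h.torus_add_one]
    congr 1
    ring
  have hHd : DisjointCurves H c :=
    ⟨h.contDiff_torus δ (by fun_prop) (by fun_prop), hcs, fun _ _ => hne _ _ _⟩
  obtain ⟨n, hn⟩ := linkingNumber_mem_int hHd hc1 (by simpa using hHp 0)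
  simp only [e₁, e₂, e₃, e₄] at key
  rw [linkingNumber_const_left, hHd.linkingNumber_comp_left hHp, hm, hn, add_zero] at key
  exact ⟨2 * n + 1, ⟨n, rfl⟩, by rw [key]; push_cast; ring⟩

end IsTube

/-! ### The normal frame of a Möbius band -/

/-- The cross product on Euclidean three-space. -/
noncomputable def cross (a b : Space) : Space :=
  !₂[a 1 * b 2 - a 2 * b 1, a 2 * b 0 - a 0 * b 2, a 0 * b 1 - a 1 * b 0]

lemma inner_eq_sum_coords (a b : Space) : inner ℝ a b = a 0 * b 0 + a 1 * b 1 + a 2 * b 2 := by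
  simp [PiLp.inner_apply, Fin.sum_univ_three]
  ring

lemma norm_sq_eq_sum_coords (a : Space) : ‖a‖ ^ 2 = a 0 ^ 2 + a 1 ^ 2 + a 2 ^ 2 := by
  rw [← real_inner_self_eq_norm_sq, inner_eq_sum_coords]
  ring

lemma inner_left_cross (a b : Space) : inner ℝ a (cross a b) = 0 := by
  simp only [inner_eq_sum_coords, cross, Matrix.cons_val]
  ring

lemma inner_right_cross (a b : Space) : inner ℝ b (cross a b) = 0 := by
  simp only [inner_eq_sum_coords, cross, Matrix.cons_val]
  ring

lemma norm_cross_sq (a b : Space) : ‖cross a b‖ ^ 2 = ‖a‖ ^ 2 * ‖b‖ ^ 2 - inner ℝ a b ^ 2 := by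
  simp only [norm_sq_eq_sum_coords, inner_eq_sum_coords, cross, Matrix.cons_val]
  ring

lemma tripleProduct_cross (a b : Space) : tripleProduct (cross a b) a b = ‖cross a b‖ ^ 2 := by
  simp only [norm_sq_eq_sum_coords, tripleProduct, cross, Matrix.cons_val]
  ring

lemma cross_neg (a b : Space) : cross a (-b) = -cross a b := by
  ext i
  fin_cases i <;> simp [cross] <;> ring

lemma cross_ne_zero {a b : Space} (h : LinearIndependent ℝ ![a, b]) : cross a b ≠ 0 := by
  intro h0
  have ha : a ≠ 0 := h.ne_zero 0
  have h1 : ‖‖a‖ ^ 2 • b - inner ℝ a b • a‖ ^ 2 = ‖a‖ ^ 2 * ‖cross a b‖ ^ 2 := by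
    rw [norm_sub_sq_real, norm_cross_sq]
    simp only [norm_smul, inner_smul_left, inner_smul_right, mul_pow, Real.norm_eq_abs, sq_abs,
      conj_trivial, real_inner_comm a b]
    ring
  rw [h0, norm_zero, zero_pow two_ne_zero, mul_zero, sq_eq_zero_iff, norm_eq_zero] at h1
  have h2 := LinearIndependent.pair_iff.1 h (-inner ℝ a b) (‖a‖ ^ 2) (by
    rw [← h1, neg_smul]; abel)
  exact ha (norm_eq_zero.1 (pow_eq_zero_iff two_ne_zero |>.1 h2.2))

lemma normalFrame_cross {a v : Space} (h : LinearIndependent ℝ ![a, v]) :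
    NormalFrame a v (‖a‖⁻¹ • cross a v) := by
  have ha : 0 < ‖a‖ := norm_pos_iff.2 (h.ne_zero 0)
  have hn : ‖‖a‖⁻¹ • cross a v‖ ^ 2 = (‖a‖ ^ 2)⁻¹ * ‖cross a v‖ ^ 2 := by
    rw [norm_smul, mul_pow, norm_inv, norm_norm, inv_pow]
  refine ⟨ha, norm_pos_iff.2 (smul_ne_zero (inv_ne_zero ha.ne') (cross_ne_zero h)), ?_, ?_, ?_, ?_⟩
  · rw [inner_smul_right, inner_left_cross, mul_zero]
  · rw [inner_smul_right, inner_right_cross, mul_zero]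
  · rw [hn, ← norm_cross_sq, mul_inv_cancel_left₀ (by positivity)]
  · have : tripleProduct (‖a‖⁻¹ • cross a v) a v = ‖a‖⁻¹ * tripleProduct (cross a v) a v := by
      simp only [tripleProduct, PiLp.smul_apply, smul_eq_mul]
      ring
    rw [this, tripleProduct_cross, hn]
    field_simp

/-- A smooth parametrization of an embedded Möbius band by `ℝ × [-1, 1]`. -/
structure IsMobiusBand (Φ : ℝ × ℝ → Space) : Prop where
  contDiff : ContDiff ℝ (⊤ : ℕ∞) Φ
  glue : ∀ s t : ℝ, Φ (s + 1, t) = Φ (s, -t)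
  injOn : Set.InjOn Φ (Set.Ico (0 : ℝ) 1 ×ˢ Set.Icc (-1 : ℝ) 1)
  immersive : ∀ p : ℝ × ℝ, p.2 ∈ Set.Icc (-1 : ℝ) 1 → Function.Injective (fderiv ℝ Φ p)

namespace IsMobiusBand

variable {Φ : ℝ × ℝ → Space}

lemma add_two (h : IsMobiusBand Φ) (s t : ℝ) : Φ (s + 2, t) = Φ (s, t) := by
  rw [show s + 2 = s + 1 + 1 by ring, h.glue, h.glue, neg_neg]

lemma exists_sign (h : IsMobiusBand Φ) (k : ℤ) : ∃ σ : ℝ, |σ| = 1 ∧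
    ∀ s t, Φ (s + k, t) = Φ (s, σ * t) := by
  rcases Int.even_or_odd' k with ⟨m, rfl | rfl⟩
  · refine ⟨1, by simp, fun s t => ?_⟩
    have hp : Function.Periodic (fun s => Φ (s, t)) 2 := fun s => h.add_two s t
    have := hp.int_mul m s
    rw [one_mul, ← this]
    push_cast
    ring_nf
  · refine ⟨-1, by simp, fun s t => ?_⟩
    have hp : Function.Periodic (fun s => Φ (s, -t)) 2 := fun s => h.add_two s (-t)
    have := hp.int_mul m s
    rw [neg_one_mul, ← this, ← h.glue]
    push_cast
    ring_nf

lemma abs_eq_of_eq (h : IsMobiusBand Φ) {s t u v : ℝ} (hu : |u| ≤ 1) (hv : |v| ≤ 1)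
    (he : Φ (s, u) = Φ (t, v)) : |u| = |v| ∧ ∃ k : ℤ, s = t + k := by
  obtain ⟨σ, hσ, h1⟩ := h.exists_sign ⌊s⌋
  obtain ⟨τ, hτ, h2⟩ := h.exists_sign ⌊t⌋
  have hmem : ∀ x σ y : ℝ, |σ| = 1 → |y| ≤ 1 →
      (Int.fract x, σ * y) ∈ Set.Ico (0 : ℝ) 1 ×ˢ Set.Icc (-1 : ℝ) 1 := fun x σ y hσ hy =>
    ⟨⟨Int.fract_nonneg x, Int.fract_lt_one x⟩, abs_le.1 (by simpa [abs_mul, hσ] using hy)⟩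
  rw [← Int.fract_add_floor s, ← Int.fract_add_floor t, h1, h2] at he
  have h3 := h.injOn (hmem s σ u hσ hu) (hmem t τ v hτ hv) he
  rw [Prod.mk.injEq] at h3
  constructor
  · simpa [abs_mul, hσ, hτ] using congrArg abs h3.2
  · refine ⟨⌊s⌋ - ⌊t⌋, ?_⟩
    have h4 := Int.fract_add_floor s
    have h5 := Int.fract_add_floor t
    push_cast
    linarith [h3.1]

/-- The velocity of the core circle. -/
noncomputable def longitude (Φ : ℝ × ℝ → Space) (s : ℝ) : Space := fderiv ℝ Φ (s, 0) (1, 0)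

/-- The direction of the fibres along the core circle. -/
noncomputable def fibre (Φ : ℝ × ℝ → Space) (s : ℝ) : Space := fderiv ℝ Φ (s, 0) (0, 1)

/-- A normal vector field of the band along the core circle. -/
noncomputable def normal (Φ : ℝ × ℝ → Space) (s : ℝ) : Space :=
  ‖longitude Φ 0‖⁻¹ • cross (longitude Φ s) (fibre Φ s)

/-- Tubular coordinates around the core circle, in which the band is `y = 0`. -/
noncomputable def tube (Φ : ℝ × ℝ → Space) (p : ℝ × ℝ × ℝ) : Space :=
  Φ (p.1, p.2.1) + p.2.2 • normal Φ p.1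

lemma differentiable (h : IsMobiusBand Φ) : Differentiable ℝ Φ :=
  h.contDiff.differentiable (by simp)

lemma longitude_eq_deriv (h : IsMobiusBand Φ) (s : ℝ) :
    longitude Φ s = deriv (fun s => Φ (s, 0)) s :=
  ((h.differentiable (s, 0)).hasFDerivAt.comp_hasDerivAt s
    ((hasDerivAt_id s).prodMk (hasDerivAt_const s (0 : ℝ)))).deriv.symm

lemma fibre_eq_deriv (h : IsMobiusBand Φ) (s : ℝ) :
    fibre Φ s = deriv (fun t => Φ (s, t)) 0 :=
  ((h.differentiable (s, 0)).hasFDerivAt.comp_hasDerivAt 0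
    ((hasDerivAt_const (0 : ℝ) s).prodMk (hasDerivAt_id (0 : ℝ)))).deriv.symm

lemma longitude_add_one (h : IsMobiusBand Φ) (s : ℝ) : longitude Φ (s + 1) = longitude Φ s := by
  have hp : Function.Periodic (fun s => Φ (s, 0)) 1 := fun s => by simp [h.glue]
  rw [h.longitude_eq_deriv, h.longitude_eq_deriv, hp.deriv]

lemma fibre_add_one (h : IsMobiusBand Φ) (s : ℝ) : fibre Φ (s + 1) = -fibre Φ s := by
  rw [h.fibre_eq_deriv, h.fibre_eq_deriv]
  simp only [h.glue]
  rw [deriv_comp_neg (fun t => Φ (s, t)), neg_zero]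

lemma normal_add_one (h : IsMobiusBand Φ) (s : ℝ) : normal Φ (s + 1) = -normal Φ s := by
  rw [normal, h.longitude_add_one, h.fibre_add_one, cross_neg, smul_neg, normal]

lemma contDiff_normal (h : IsMobiusBand Φ) : ContDiff ℝ 1 (normal Φ) := by
  have h1 : ContDiff ℝ 1 (fderiv ℝ Φ) := h.contDiff.fderiv_right (by norm_cast)
  have h2 : ContDiff ℝ 1 fun s : ℝ => fderiv ℝ Φ (s, 0) := h1.comp (by fun_prop)
  have ha : ContDiff ℝ 1 (longitude Φ) := h2.clm_apply contDiff_const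
  have hv : ContDiff ℝ 1 (fibre Φ) := h2.clm_apply contDiff_const
  rw [contDiff_euclidean] at ha hv
  refine ContDiff.const_smul _ (contDiff_euclidean.2 fun i => ?_)
  fin_cases i
  · exact ((ha 1).mul (hv 2)).sub ((ha 2).mul (hv 1))
  · exact ((ha 2).mul (hv 0)).sub ((ha 0).mul (hv 2))
  · exact ((ha 0).mul (hv 1)).sub ((ha 1).mul (hv 0))

lemma contDiff_one (h : IsMobiusBand Φ) : ContDiff ℝ 1 Φ :=
  h.contDiff.of_le (by norm_cast)

lemma contDiff_tube (h : IsMobiusBand Φ) : ContDiff ℝ 1 (tube Φ) := by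
  have h1 := h.contDiff_one
  have h2 := h.contDiff_normal
  unfold tube
  fun_prop

lemma fderiv_band (s x y : ℝ) :
    fderiv ℝ Φ (s, 0) (x, y) = x • longitude Φ s + y • fibre Φ s := by
  rw [longitude, fibre, ← map_smul, ← map_smul, ← map_add]
  simp

lemma fderiv_tube (h : IsMobiusBand Φ) (s x y z : ℝ) :
    fderiv ℝ (tube Φ) (s, 0, 0) (x, y, z) =
      x • longitude Φ s + (y • fibre Φ s + z • normal Φ s) := by
  have h1 : HasFDerivAt (fun p : ℝ × ℝ × ℝ => Φ (p.1, p.2.1)) _ (s, 0, 0) :=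
    HasFDerivAt.comp (g := Φ) (f := fun p : ℝ × ℝ × ℝ => (p.1, p.2.1)) (s, (0 : ℝ), (0 : ℝ))
      (h.differentiable (s, 0)).hasFDerivAt
      (hasFDerivAt_fst.prodMk
        ((ContinuousLinearMap.fst ℝ ℝ ℝ).comp (ContinuousLinearMap.snd ℝ ℝ (ℝ × ℝ))).hasFDerivAt)
  have h2 : HasFDerivAt (fun p : ℝ × ℝ × ℝ => normal Φ p.1) _ (s, 0, 0) :=
    HasFDerivAt.comp (g := normal Φ) (f := fun p : ℝ × ℝ × ℝ => p.1) (s, (0 : ℝ), (0 : ℝ))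
      (h.contDiff_normal.differentiable one_ne_zero s).hasFDerivAt hasFDerivAt_fst
  have h3 : HasFDerivAt (fun p : ℝ × ℝ × ℝ => p.2.2) _ (s, 0, 0) :=
    ((ContinuousLinearMap.snd ℝ ℝ ℝ).comp (ContinuousLinearMap.snd ℝ ℝ (ℝ × ℝ))).hasFDerivAt
  have h4 := (h1.add (h3.smul h2)).fderiv
  refine (congrArg (fun L : ℝ × ℝ × ℝ →L[ℝ] Space => L (x, y, z)) h4).trans ?_
  simp [fderiv_band, add_assoc]

lemma linearIndependent (h : IsMobiusBand Φ) (s : ℝ) :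
    LinearIndependent ℝ ![longitude Φ s, fibre Φ s] := by
  refine LinearIndependent.pair_iff.2 fun x y hxy => ?_
  rw [← fderiv_band, ← map_zero (fderiv ℝ Φ (s, 0))] at hxy
  simpa using h.immersive (s, 0) (by simp) hxy

lemma isTube (h : IsMobiusBand Φ) : IsTube (tube Φ) where
  contDiff := h.contDiff_tube
  glue s x y := by simp [tube, h.glue, h.normal_add_one]
  core_inj s t hst := by
    simp only [tube, zero_smul, add_zero] at hst
    exact (h.abs_eq_of_eq (by simp) (by simp) hst).2
  immersive s := by
    rw [injective_iff_map_eq_zero]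
    rintro ⟨x, y, z⟩ h0
    rw [h.fderiv_tube] at h0
    have hκ : ‖longitude Φ 0‖⁻¹ ≠ 0 :=
      inv_ne_zero (norm_ne_zero_iff.2 ((h.linearIndependent 0).ne_zero 0))
    have hn : normal Φ s ≠ 0 := smul_ne_zero hκ (cross_ne_zero (h.linearIndependent s))
    have h1 := congrArg (fun u => inner ℝ u (normal Φ s)) h0
    simp only [inner_add_left, inner_smul_left, conj_trivial, inner_zero_left] at h1
    have h2 : inner ℝ (longitude Φ s) (normal Φ s) = 0 := by
      rw [normal, inner_smul_right, inner_left_cross, mul_zero]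
    have h3 : inner ℝ (fibre Φ s) (normal Φ s) = 0 := by
      rw [normal, inner_smul_right, inner_right_cross, mul_zero]
    rw [h2, h3, mul_zero, mul_zero, zero_add, zero_add, mul_eq_zero, inner_self_eq_zero] at h1
    obtain rfl := h1.resolve_right hn
    rw [zero_smul, add_zero] at h0
    obtain ⟨rfl, rfl⟩ := LinearIndependent.pair_iff.1 (h.linearIndependent s) x y h0
    rfl

/-- The boundary of a Möbius band has odd linking number with its core. -/
lemma odd_linkingNumber_core (h : IsMobiusBand Φ) : ∃ m : ℤ, Odd m ∧
    linkingNumber (fun s => Φ (2 * s, 1)) (fun t => Φ (t, 0)) = m := by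
  obtain ⟨r, hr0, hr⟩ := h.isTube.exists_isRadius
  obtain ⟨δ, hm, hδ⟩ := ((h.isTube.eventually_linkingNumber_meridian
    (normalFrame_cross (h.linearIndependent 0)) (h.fderiv_tube 0)).and
      (Ioc_mem_nhdsGT (lt_min hr0 one_pos))).exists
  obtain ⟨m, hodd, hL⟩ := h.isTube.odd_linkingNumber hr hδ.1 (hδ.2.trans (min_le_left _ _)) hm
  refine ⟨m, hodd, ?_⟩
  rw [← hL]
  simp only [tube, zero_smul, add_zero]
  refine linkingNumber_eq_of_homotopy (Γ := fun p => Φ (2 * p.2, p.1)) (C := fun p => Φ (p.2, 0))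
    (h.contDiff_one.comp (by fun_prop)) (h.contDiff_one.comp (by fun_prop)) ?_ ?_ ?_
  · intro x hx s t he
    rw [Set.uIcc_of_ge (hδ.2.trans (min_le_right _ _))] at hx
    have hx0 : 0 < x := hδ.1.trans_le hx.1
    have := (h.abs_eq_of_eq (by rw [abs_of_pos hx0]; exact hx.2) (by simp) he).1
    rw [abs_of_pos hx0, abs_zero] at this
    exact hx0.ne' this
  · intro x
    simpa using h.add_two 0 x
  · intro x
    simpa using h.glue 0 0

/-- The push-in of the boundary is homotopic to the doubly traversed core. -/
lemma linkingNumber_pushIn (h : IsMobiusBand Φ) {ε : ℝ} (hε0 : 0 < ε) (hε2 : ε < 2) :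
    linkingNumber (fun s => Φ (2 * s, 1)) (fun s => Φ (2 * s, 1 - ε)) =
      2 * linkingNumber (fun s => Φ (2 * s, 1)) (fun t => Φ (t, 0)) := by
  have hne : ∀ x, |x| < 1 → ∀ s t, Φ (s, 1) ≠ Φ (t, x) := fun x hx s t he => by
    have := (h.abs_eq_of_eq (by simp) hx.le he).1
    rw [abs_one] at this
    exact hx.ne this.symm
  have hd : DisjointCurves (fun s => Φ (2 * s, 1)) (fun t => Φ (t, 0)) :=
    ⟨h.contDiff_one.comp (by fun_prop), h.contDiff_one.comp (by fun_prop),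
      fun _ _ => hne 0 (by simp) _ _⟩
  rw [← hd.linkingNumber_comp_right fun t => by simp [h.glue]]
  refine linkingNumber_eq_of_homotopy (Γ := fun p => Φ (2 * p.2, 1))
    (C := fun p => Φ (2 * p.2, p.1)) (h.contDiff_one.comp (by fun_prop))
    (h.contDiff_one.comp (by fun_prop)) ?_ (fun x => by simpa using h.add_two 0 1)
    fun x => by simpa using h.add_two 0 x
  intro x hx s t
  refine hne x ?_ _ _
  have h1 : |1 - ε| < 1 := abs_lt.2 ⟨by linarith, by linarith⟩
  rcases Set.mem_uIcc.1 hx with h2 | h2 <;> rw [abs_lt] at h1 ⊢ <;> constructor <;> linarith [h2.1, h2.2]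

end IsMobiusBand

/-- If `M ⊂ ℝ³` is a smoothly embedded Möbius strip — realized as the image of the
band `ℝ × [-1,1]` under a smooth map `Φ` with the Möbius identification
`Φ(s+1, t) = Φ(s, -t)`, injective on the fundamental domain `[0,1) × [-1,1]` and
immersive on the band — then `λ(M)/2` is an odd integer; in particular
`λ(M) ≠ 0`.  Here `λ(M)` is the linking number of the boundary curve
`s ↦ Φ(2s, 1)` of `M` with its parallel push-in `s ↦ Φ(2s, 1-ε)` into `M`. -/
theorem stmt_12 (Φ : ℝ × ℝ → EuclideanSpace ℝ (Fin 3)) (hΦ : ContDiff ℝ (⊤ : ℕ∞) Φ)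
    (hglue : ∀ s t : ℝ, Φ (s + 1, t) = Φ (s, -t))
    (hinj : Set.InjOn Φ (Set.Ico (0 : ℝ) 1 ×ˢ Set.Icc (-1 : ℝ) 1))
    (himm : ∀ p : ℝ × ℝ, p.2 ∈ Set.Icc (-1 : ℝ) 1 → Function.Injective (fderiv ℝ Φ p))
    (ε : ℝ) (hε0 : 0 < ε) (hε2 : ε < 2) :
    ∃ m : ℤ, Odd m ∧
      linkingNumber (fun s => Φ (2 * s, 1)) (fun s => Φ (2 * s, 1 - ε)) = 2 * (m : ℝ) := by
  have h : IsMobiusBand Φ := ⟨hΦ, hglue, hinj, himm⟩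
  obtain ⟨m, hm, hL⟩ := h.odd_linkingNumber_core
  exact ⟨m, hm, by rw [h.linkingNumber_pushIn hε0 hε2, hL]⟩
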